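/- arXiv:0911.3971 — 2 statements merged into one kernel-verified Lean document; each statement's English description precedes it below -/
import Mathlib

section
/- Let Ω = {θ_n}_{n≥1} ⊂ (0, π/2] be a lacunary sequence, i.e. θ_{n+1} ≤ A·θ_n for all n for some fixed constant 0 < A < 1. Then there exists a constant C > 0 such that for every N ≥ 2 there is a set P of N points in [0,1]² with the property that for every rectangle R ∈ A_Ω with R ⊆ [0,1]², one has |#(P ∩ R) − N·area(R)| ≤ C (log N)³. In other words, D_Ω(N) ≲ (log N)³. -/
open MeasureTheory

noncomputable section

/-- Rotation of the plane by angle `φ`. -/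
def rot (φ : ℝ) (x : ℝ × ℝ) : ℝ × ℝ :=
  (x.1 * Real.cos φ - x.2 * Real.sin φ, x.1 * Real.sin φ + x.2 * Real.cos φ)

/-- The rectangle obtained by rotating `[0,w] × [0,h]` by angle `φ` and translating by `p`.
One of its sides makes angle `φ` with the x-axis. -/
def rect (φ : ℝ) (p : ℝ × ℝ) (w h : ℝ) : Set (ℝ × ℝ) :=
  (fun x => p + rot φ x) '' (Set.Icc 0 w ×ˢ Set.Icc 0 h)

/-- The unit square `[0,1]²`. -/
def unitSq : Set (ℝ × ℝ) := Set.Icc (0:ℝ) 1 ×ˢ Set.Icc (0:ℝ) 1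

/-- `plog n = max {1, log₂ n}`. -/
def plog (n : ℕ) : ℝ := max 1 (Real.logb 2 n)

/-- The sawtooth function. -/
def saw (x : ℝ) : ℝ := Int.fract x - 1 / 2

lemma abs_saw_le (x : ℝ) : |saw x| ≤ 1 / 2 := by
  unfold saw
  rw [abs_le]
  constructor <;> linarith [Int.fract_nonneg x, Int.fract_lt_one x]

lemma saw_le_saw_sub_add {x y ε : ℝ} (h : |x - y| ≤ ε) : saw x ≤ saw (y - ε) + 2 * ε := by
  have h1 := abs_le.1 h
  have h2 : ⌊y - ε⌋ ≤ ⌊x⌋ := Int.floor_le_floor (by linarith)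
  have h3 : (⌊y - ε⌋ : ℝ) ≤ ⌊x⌋ := by exact_mod_cast h2
  simp only [saw, Int.fract]
  linarith

lemma saw_add_sub_le_saw {x y ε : ℝ} (h : |x - y| ≤ ε) : saw (y + ε) - 2 * ε ≤ saw x := by
  have h1 := abs_le.1 h
  have h2 : ⌊x⌋ ≤ ⌊y + ε⌋ := Int.floor_le_floor (by linarith)
  have h3 : (⌊x⌋ : ℝ) ≤ ⌊y + ε⌋ := by exact_mod_cast h2
  simp only [saw, Int.fract]
  linarith

/-- Sawtooth sums are stable under small perturbations of the nodes, up to a common shift. -/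
lemma abs_sum_saw_le_of_close {ι : Type*} (S : Finset ι) (x y : ι → ℝ) {ε B : ℝ}
    (h : ∀ i ∈ S, |x i - y i| ≤ ε) (hB : ∀ γ : ℝ, |∑ i ∈ S, saw (y i + γ)| ≤ B) :
    |∑ i ∈ S, saw (x i)| ≤ B + 2 * ε * S.card := by
  have h1 : ∑ i ∈ S, saw (x i) ≤ ∑ i ∈ S, (saw (y i + -ε) + 2 * ε) :=
    Finset.sum_le_sum fun i hi => by
      simpa [sub_eq_add_neg] using saw_le_saw_sub_add (h i hi)
  have h2 : ∑ i ∈ S, (saw (y i + ε) - 2 * ε) ≤ ∑ i ∈ S, saw (x i) :=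
    Finset.sum_le_sum fun i hi => saw_add_sub_le_saw (h i hi)
  rw [Finset.sum_add_distrib, Finset.sum_const, nsmul_eq_mul] at h1
  rw [Finset.sum_sub_distrib, Finset.sum_const, nsmul_eq_mul] at h2
  have h3 := abs_le.1 (hB (-ε))
  have h4 := abs_le.1 (hB ε)
  rw [abs_le]
  constructor <;> linarith

lemma fract_int_add_div (d : ℕ) (hd : 0 < d) (m : ℤ) (ε : ℝ) (h0 : 0 ≤ ε) (h1 : ε < 1) :
    Int.fract (((m : ℝ) + ε) / d) = (((m % d : ℤ) : ℝ) + ε) / d := by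
  have hd' : (0 : ℝ) < d := by exact_mod_cast hd
  have hdz : (d : ℤ) ≠ 0 := by exact_mod_cast hd.ne'
  have hm : (m : ℝ) = d * ((m / d : ℤ) : ℝ) + ((m % d : ℤ) : ℝ) := by
    exact_mod_cast (Int.mul_ediv_add_emod m d).symm
  rw [Int.fract_eq_iff]
  have h2 : (0 : ℝ) ≤ ((m % d : ℤ) : ℝ) := by exact_mod_cast Int.emod_nonneg m hdz
  have h3 : m % d + 1 ≤ (d : ℤ) := Int.emod_lt_of_pos m (by exact_mod_cast hd)
  have h4 : ((m % d : ℤ) : ℝ) + 1 ≤ d := by exact_mod_cast h3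
  refine ⟨by positivity, (div_lt_one hd').2 (by linarith), m / d, ?_⟩
  rw [← sub_div, div_eq_iff hd'.ne']
  linarith

/-- Over a full period the sawtooth sum along a rational rotation is bounded by `1/2`. -/
lemma abs_sum_saw_rat_le (r : ℚ) (x : ℝ) :
    |∑ i ∈ Finset.range r.den, saw (i * (r : ℝ) + x)| ≤ 1 / 2 := by
  set d := r.den with hd
  have hdpos : 0 < d := r.den_pos
  have hd' : (0 : ℝ) < d := by exact_mod_cast hdpos
  have hdz : (d : ℤ) ≠ 0 := by exact_mod_cast hdpos.ne'
  set k : ℤ := ⌊d * x⌋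
  set ε : ℝ := Int.fract (d * x)
  have hx : (k : ℝ) + ε = d * x := Int.floor_add_fract _
  have hr : (r : ℝ) = r.num / d := by rw [hd]; exact_mod_cast (Rat.num_div_den r).symm
  have hε0 : 0 ≤ ε := Int.fract_nonneg _
  have hε1 : ε < 1 := Int.fract_lt_one _
  let g : ℕ → ℕ := fun i => ((i * r.num + k) % d).toNat
  have hg : ∀ i, ((g i : ℕ) : ℤ) = (i * r.num + k) % d := fun i =>
    Int.toNat_of_nonneg (Int.emod_nonneg _ hdz)
  have hterm : ∀ i : ℕ, saw (i * (r : ℝ) + x) = ((g i : ℝ) + ε) / d - 1 / 2 := by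
    intro i
    have e1 : (i * (r : ℝ) + x) = (((i * r.num + k : ℤ) : ℝ) + ε) / d := by
      rw [hr]; push_cast; field_simp; linarith
    rw [saw, e1, fract_int_add_div d hdpos _ _ hε0 hε1, ← hg i]
    simp
  have hmaps : ∀ i ∈ Finset.range d, g i ∈ Finset.range d := by
    intro i _
    rw [Finset.mem_range]
    have := Int.emod_lt_of_pos (i * r.num + k) (show (0 : ℤ) < d by exact_mod_cast hdpos)
    rw [← hg i] at this
    exact_mod_cast this
  have hinj : Set.InjOn g (Finset.range d : Set ℕ) := by
    intro i hi i' hi' h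
    simp only [Finset.coe_range, Set.mem_Iio] at hi hi'
    have h1 : (i * r.num + k) % d = (i' * r.num + k) % d := by rw [← hg, ← hg, h]
    have h2 : (d : ℤ) ∣ (i' * r.num + k) - (i * r.num + k) := Int.ModEq.dvd h1
    have h3 : (d : ℤ) ∣ r.num * ((i' : ℤ) - i) := by convert h2 using 1; ring
    have hcop : IsCoprime (d : ℤ) r.num := by
      have := r.isCoprime_num_den
      exact this.symm
    have h4 : (d : ℤ) ∣ (i' : ℤ) - i := hcop.dvd_of_dvd_mul_left h3
    have h5 : (i' : ℤ) - i = 0 := by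
      apply Int.eq_zero_of_abs_lt_dvd h4
      rw [abs_lt]; constructor <;> lia
    lia
  have himg : (Finset.range d).image g = Finset.range d :=
    Finset.eq_of_subset_of_card_le (Finset.image_subset_iff.2 hmaps)
      (by rw [Finset.card_image_of_injOn hinj])
  have hsum : ∑ i ∈ Finset.range d, (g i : ℝ) = ∑ i ∈ Finset.range d, (i : ℝ) := by
    conv_rhs => rw [← himg]
    rw [Finset.sum_image hinj]
  have hgauss : ∑ i ∈ Finset.range d, (i : ℝ) = d * (d - 1) / 2 := by
    clear_value d
    clear * -
    induction d with
    | zero => simp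
    | succ n ih => rw [Finset.sum_range_succ, ih]; push_cast; ring
  have : ∑ i ∈ Finset.range d, saw (i * (r : ℝ) + x) = ε - 1 / 2 := by
    simp_rw [hterm]
    rw [Finset.sum_sub_distrib, ← Finset.sum_div, Finset.sum_add_distrib, hsum, hgauss]
    simp
    field_simp
    ring
  rw [this, abs_le]
  constructor <;> linarith

/-- A block whose length is the denominator of a good rational approximation. -/
lemma abs_sum_saw_block_le {β : ℝ} {r : ℚ} {n : ℕ}
    (hr : |β - r| ≤ 1 / ((n + 1) * r.den)) (hn : r.den ≤ n) (γ : ℝ) :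
    |∑ i ∈ Finset.range r.den, saw (i * β + γ)| ≤ 3 := by
  have hd : (0 : ℝ) < r.den := by exact_mod_cast r.den_pos
  have hn' : (r.den : ℝ) ≤ n := by exact_mod_cast hn
  have hclose : ∀ i ∈ Finset.range r.den, |(i * β + γ) - (i * (r : ℝ) + γ)| ≤ 1 / r.den := by
    intro i hi
    have hi' : (i : ℝ) ≤ r.den := by exact_mod_cast (Finset.mem_range.1 hi).le
    have e : (i * β + γ) - (i * (r : ℝ) + γ) = i * (β - r) := by ring
    rw [e, abs_mul, Nat.abs_cast]
    calc (i : ℝ) * |β - r| ≤ r.den * (1 / ((n + 1) * r.den)) := by gcongr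
      _ = 1 / (n + 1) := by field_simp
      _ ≤ 1 / r.den := by gcongr; linarith
  have h := abs_sum_saw_le_of_close (Finset.range r.den) (fun i => i * β + γ)
    (fun i => i * (r : ℝ) + γ) hclose
    (fun δ => by simpa [add_assoc] using abs_sum_saw_rat_le r (γ + δ))
  refine h.trans ?_
  rw [Finset.card_range, mul_assoc, one_div_mul_cancel hd.ne']
  norm_num

/-- Distance to the nearest integer at most `ε`. -/
def nearInt (ε : ℝ) : Set ℝ := {y | |y - round y| ≤ ε}

/-- A majorant of `2 ^ j / d`, for `d` the denominator of a Dirichlet approximation of `β`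
at height `2 ^ j`. -/
def dirichletWeight (j : ℕ) (β : ℝ) : ℝ :=
  ∑ q ∈ Finset.Icc (1 : ℕ) (2 ^ j), (2 ^ j / q : ℝ) * (nearInt (1 / 2 ^ j)).indicator 1 (q * β)

lemma dirichletWeight_nonneg (j : ℕ) (β : ℝ) : 0 ≤ dirichletWeight j β :=
  Finset.sum_nonneg fun q _ => mul_nonneg (by positivity)
    (Set.indicator_nonneg (fun _ _ => zero_le_one) _)

lemma le_dirichletWeight {j : ℕ} {β : ℝ} {r : ℚ}
    (hr : |β - r| ≤ 1 / (((2 ^ j : ℕ) + 1) * r.den)) (hn : r.den ≤ 2 ^ j) :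
    (2 ^ j / r.den : ℝ) ≤ dirichletWeight j β := by
  have hd : (0 : ℝ) < r.den := by exact_mod_cast r.den_pos
  have hmem : (r.den : ℝ) * β ∈ nearInt (1 / 2 ^ j) := by
    refine (round_le ((r.den : ℝ) * β) r.num).trans ?_
    have e : (r.den : ℝ) * β - r.num = r.den * (β - r) := by
      have hr : (r : ℝ) = r.num / r.den := by exact_mod_cast (Rat.num_div_den r).symm
      rw [hr]; field_simp
    rw [e, abs_mul, Nat.abs_cast]
    calc (r.den : ℝ) * |β - r| ≤ r.den * (1 / (((2 ^ j : ℕ) + 1) * r.den)) := by gcongr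
      _ = 1 / (2 ^ j + 1) := by push_cast; field_simp
      _ ≤ 1 / 2 ^ j := by gcongr; linarith
  have h := Finset.single_le_sum
    (f := fun q : ℕ => (2 ^ j / q : ℝ) * (nearInt (1 / 2 ^ j)).indicator 1 (q * β))
    (fun q _ => mul_nonneg (by positivity) (Set.indicator_nonneg (fun _ _ => zero_le_one) _))
    (Finset.mem_Icc.2 ⟨r.den_pos, hn⟩)
  rwa [Set.indicator_of_mem hmem, Pi.one_apply, mul_one] at h

lemma abs_sum_saw_mul_le {β : ℝ} {d : ℕ} {B : ℝ}
    (hB : ∀ γ : ℝ, |∑ i ∈ Finset.range d, saw (i * β + γ)| ≤ B) (b : ℕ) (γ : ℝ) :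
    |∑ i ∈ Finset.range (d * b), saw (i * β + γ)| ≤ b * B := by
  induction b with
  | zero => simp
  | succ b ih =>
    rw [Nat.mul_succ, Finset.sum_range_add]
    have h := hB ((d * b : ℕ) * β + γ)
    have e : ∀ i : ℕ, ((d * b + i : ℕ) : ℝ) * β + γ = i * β + ((d * b : ℕ) * β + γ) := by
      intro i; push_cast; ring
    simp_rw [e]
    refine (abs_add_le _ _).trans ?_
    push_cast at *
    linarith

/-- Bound for the sawtooth sums along the rotation by `β` of length at most `2 ^ J`. -/
def rotationBound (J : ℕ) (β : ℝ) : ℝ := 1 + ∑ j ∈ Finset.range J, 6 * dirichletWeight j β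

lemma one_le_rotationBound (J : ℕ) (β : ℝ) : 1 ≤ rotationBound J β := by
  unfold rotationBound
  linarith [Finset.sum_nonneg (s := Finset.range J) (f := fun j => 6 * dirichletWeight j β)
    fun j _ => by linarith [dirichletWeight_nonneg j β]]

lemma abs_sum_range_saw_le (J : ℕ) (β : ℝ) : ∀ (L : ℕ), L ≤ 2 ^ J → ∀ γ : ℝ,
    |∑ i ∈ Finset.range L, saw (i * β + γ)| ≤ rotationBound J β := by
  induction J with
  | zero =>
    intro L hL γ
    refine le_trans ?_ (one_le_rotationBound 0 β)
    have : L = 0 ∨ L = 1 := by simp at hL; lia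
    rcases this with rfl | rfl
    · simp
    · simp only [Finset.range_one, Finset.sum_singleton]
      exact (abs_saw_le _).trans (by norm_num)
  | succ J ih =>
    intro L hL γ
    obtain ⟨r, hr, hd⟩ := Real.exists_rat_abs_sub_le_and_den_le β (n := 2 ^ J) (by positivity)
    have hdpos : (0 : ℝ) < r.den := by exact_mod_cast r.den_pos
    have hw := le_dirichletWeight hr hd
    have hL' : L = r.den * (L / r.den) + L % r.den := (Nat.div_add_mod L r.den).symm
    have hmod : L % r.den ≤ 2 ^ J := (Nat.mod_lt _ r.den_pos).le.trans hd
    have h1 := abs_sum_saw_mul_le (fun γ => abs_sum_saw_block_le hr hd γ) (L / r.den) γ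
    have h2 := ih (L % r.den) hmod ((r.den * (L / r.den) : ℕ) * β + γ)
    have hq : ((L / r.den : ℕ) : ℝ) ≤ 2 * (2 ^ J / r.den) := by
      have h3 : ((L / r.den : ℕ) : ℝ) ≤ (L : ℝ) / r.den := Nat.cast_div_le
      have h4 : (L : ℝ) ≤ 2 * 2 ^ J := by
        rw [← pow_succ']; exact_mod_cast hL
      calc _ ≤ (L : ℝ) / r.den := h3
        _ ≤ 2 * 2 ^ J / r.den := by gcongr
        _ = _ := by ring
    rw [hL', Finset.sum_range_add]
    have e : ∀ i : ℕ, ((r.den * (L / r.den) + i : ℕ) : ℝ) * β + γ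
        = i * β + ((r.den * (L / r.den) : ℕ) * β + γ) := by
      intro i; push_cast; ring
    simp_rw [e]
    refine (abs_add_le _ _).trans ?_
    have h5 : rotationBound (J + 1) β = rotationBound J β + 6 * dirichletWeight J β := by
      simp [rotationBound, Finset.sum_range_succ, add_assoc]
    rw [h5]
    linarith

lemma eq_Ico_of_ordConnected (S : Finset ℕ) (hS : (S : Set ℕ).OrdConnected) :
    ∃ a b : ℕ, S = Finset.Ico a b := by
  rcases S.eq_empty_or_nonempty with rfl | hne
  · exact ⟨0, 0, by simp⟩
  · refine ⟨S.min' hne, S.max' hne + 1, ?_⟩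
    ext i
    simp only [Finset.mem_Ico, Nat.lt_succ_iff]
    refine ⟨fun hi => ⟨S.min'_le i hi, S.le_max' i hi⟩, fun hi => ?_⟩
    exact hS.out (S.min'_mem hne) (S.max'_mem hne) hi

lemma abs_sum_saw_le_of_ordConnected {J N : ℕ} (hN : N ≤ 2 ^ J) (β γ : ℝ) {S : Finset ℕ}
    (hSN : S ⊆ Finset.range N) (hS : (S : Set ℕ).OrdConnected) :
    |∑ i ∈ S, saw (i * β + γ)| ≤ rotationBound J β := by
  have hcard : S.card ≤ 2 ^ J := by
    simpa using (Finset.card_le_card hSN).trans (by simpa using hN)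
  obtain ⟨a, b, rfl⟩ := eq_Ico_of_ordConnected S hS
  rw [Nat.card_Ico] at hcard
  have h := abs_sum_range_saw_le J β (b - a) hcard (a * β + γ)
  rw [Finset.sum_Ico_eq_sum_range]
  convert h using 4
  push_cast; ring

lemma abs_sum_saw_neg_le_of_ordConnected {J N : ℕ} (hN : N ≤ 2 ^ J) (β γ : ℝ) {S : Finset ℕ}
    (hSN : S ⊆ Finset.range N) (hS : (S : Set ℕ).OrdConnected) :
    |∑ i ∈ S, saw (-(i * β) + γ)| ≤ rotationBound J β := by
  have hcard : S.card ≤ 2 ^ J := by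
    simpa using (Finset.card_le_card hSN).trans (by simpa using hN)
  obtain ⟨a, b, rfl⟩ := eq_Ico_of_ordConnected S hS
  rw [Nat.card_Ico] at hcard
  have h := abs_sum_range_saw_le J β (b - a) hcard (-((b - 1 : ℝ) * β) + γ)
  rw [Finset.sum_Ico_eq_sum_range, ← Finset.sum_range_reflect]
  convert h using 2
  refine Finset.sum_congr rfl fun i hi => ?_
  have hi' := Finset.mem_range.1 hi
  congr 1
  have : ((a + (b - a - 1 - i) : ℕ) : ℝ) = b - 1 - i := by
    rw [eq_sub_iff_add_eq, eq_sub_iff_add_eq]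
    norm_cast
    lia
  rw [this]; ring

lemma measurableSet_nearInt (ε : ℝ) : MeasurableSet (nearInt ε) := by
  have h : Measurable fun y : ℝ => |y - round y| := by
    have : (fun y : ℝ => |y - round y|) = fun y : ℝ => min (Int.fract y) (1 - Int.fract y) := by
      ext y; exact abs_sub_round_eq_min y
    rw [this]
    exact measurable_fract.min (measurable_const.sub measurable_fract)
  exact measurableSet_le h measurable_const

lemma measurable_indicator_nearInt (ε : ℝ) :
    Measurable ((nearInt ε).indicator (1 : ℝ → ℝ)) :=
  measurable_one.indicator (measurableSet_nearInt ε)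

lemma intervalIntegrable_indicator_nearInt (ε a b c d : ℝ) :
    IntervalIntegrable (fun x => (nearInt ε).indicator (1 : ℝ → ℝ) (c * (x + d))) volume a b := by
  refine (intervalIntegrable_const (c := (1 : ℝ))).mono_fun ?_ ?_
  · exact ((measurable_indicator_nearInt ε).comp (by fun_prop)).aestronglyMeasurable
  · refine Filter.Eventually.of_forall fun x => ?_
    simp only [norm_one]
    exact (norm_indicator_le_norm_self _ _).trans (by simp)

lemma periodic_indicator_nearInt (ε : ℝ) :
    Function.Periodic ((nearInt ε).indicator (1 : ℝ → ℝ)) 1 := by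
  intro x
  have : x + 1 ∈ nearInt ε ↔ x ∈ nearInt ε := by
    simp [nearInt]
  by_cases h : x ∈ nearInt ε
  · simp [h, this.2 h]
  · simp [h, mt this.1 h]

lemma integral_indicator_nearInt_le {ε : ℝ} (hε : 0 ≤ ε) :
    ∫ x in (0 : ℝ)..1, (nearInt ε).indicator (1 : ℝ → ℝ) x ≤ 2 * ε := by
  have h := (periodic_indicator_nearInt ε).intervalIntegral_add_eq 0 (-(1 / 2))
  rw [zero_add] at h
  rw [h, intervalIntegral.integral_of_le (by norm_num)]
  rw [setIntegral_indicator (measurableSet_nearInt ε)]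
  simp only [Pi.one_apply, integral_const, smul_eq_mul, mul_one, MeasurableSet.univ,
    measureReal_restrict_apply, Set.univ_inter]
  have hsub : Set.Ioc (-(1 / 2)) (-(1 / 2) + 1) ∩ nearInt ε ⊆ Set.Icc (-ε) ε := by
    rintro y ⟨hy, hn⟩
    have hn' : |y - round y| ≤ ε := hn
    rw [Set.mem_Icc, ← abs_le]
    refine le_trans ?_ hn'
    have h1 := hy.1
    have h2 : y ≤ 1 / 2 := by linarith [hy.2]
    generalize round y = z
    rcases lt_trichotomy z 0 with hz | rfl | hz
    · have : (z : ℝ) ≤ -1 := by exact_mod_cast (show z ≤ -1 by lia)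
      rw [abs_le]
      constructor <;> linarith [le_abs_self (y - z)]
    · simp
    · have : (1 : ℝ) ≤ z := by exact_mod_cast (show 1 ≤ z by lia)
      rw [abs_le]
      constructor <;> linarith [neg_le_abs (y - z)]
  calc volume.real _ ≤ volume.real (Set.Icc (-ε) ε) := measureReal_mono hsub (by simp)
    _ = 2 * ε := by
      rw [Real.volume_real_Icc_of_le (by linarith)]; ring

lemma integral_indicator_nearInt_mul_le {ε : ℝ} (hε : 0 ≤ ε) {q : ℕ} (hq : 0 < q) (s : ℝ) :
    ∫ x in (0 : ℝ)..1, (nearInt ε).indicator (1 : ℝ → ℝ) (q * (x + s)) ≤ 2 * ε := by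
  have hq' : (q : ℝ) ≠ 0 := by exact_mod_cast hq.ne'
  have h1 := intervalIntegral.integral_comp_mul_add (a := 0) (b := 1)
    ((nearInt ε).indicator (1 : ℝ → ℝ)) hq' (q * s)
  have h2 := (periodic_indicator_nearInt ε).intervalIntegral_add_zsmul_eq q (q * s)
    (fun t₁ t₂ => by simpa using intervalIntegrable_indicator_nearInt ε t₁ t₂ 1 0)
  have h3 : ∫ x in (q * s : ℝ)..(q * s + 1), (nearInt ε).indicator (1 : ℝ → ℝ) x ≤ 2 * ε := by
    have := (periodic_indicator_nearInt ε).intervalIntegral_add_eq (q * s) 0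
    rw [this, zero_add]
    exact integral_indicator_nearInt_le hε
  have e : ∀ x : ℝ, (q : ℝ) * (x + s) = q * x + q * s := fun x => by ring
  simp_rw [e]
  rw [h1]
  simp only [mul_zero, zero_add, mul_one, smul_eq_mul, natCast_zsmul, nsmul_eq_mul] at h2 ⊢
  rw [add_comm (q : ℝ), h2, ← mul_assoc, inv_mul_cancel₀ hq', one_mul]
  exact h3

lemma intervalIntegrable_finset_sum {ι : Type*} (T : Finset ι) {f : ι → ℝ → ℝ} {a b : ℝ}
    (h : ∀ i ∈ T, IntervalIntegrable (f i) volume a b) :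
    IntervalIntegrable (fun x => ∑ i ∈ T, f i x) volume a b := by
  simpa only [Finset.sum_fn] using IntervalIntegrable.sum T h

lemma intervalIntegrable_dirichletWeight (j : ℕ) (s : ℝ) :
    IntervalIntegrable (fun x => dirichletWeight j (x + s)) volume 0 1 := by
  unfold dirichletWeight
  apply intervalIntegrable_finset_sum
  intro q _
  exact (intervalIntegrable_indicator_nearInt _ _ _ _ _).const_mul _

lemma sum_Icc_one_div_le (j : ℕ) :
    ∑ q ∈ Finset.Icc (1 : ℕ) (2 ^ j), (1 / q : ℝ) ≤ 1 + j := by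
  have h := harmonic_le_one_add_log (2 ^ j)
  rw [harmonic_eq_sum_Icc] at h
  push_cast at h
  simp only [one_div]
  refine h.trans ?_
  rw [Real.log_pow]
  have : Real.log 2 ≤ 1 := by linarith [Real.log_two_lt_d9]
  have hj : (0 : ℝ) ≤ j := by positivity
  nlinarith

lemma integral_dirichletWeight_le (j : ℕ) (s : ℝ) :
    ∫ x in (0 : ℝ)..1, dirichletWeight j (x + s) ≤ 2 * (1 + j) := by
  unfold dirichletWeight
  rw [intervalIntegral.integral_finsetSum
    fun q _ => (intervalIntegrable_indicator_nearInt _ _ _ _ _).const_mul _]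
  calc _ ≤ ∑ q ∈ Finset.Icc (1 : ℕ) (2 ^ j), 2 * (1 / q : ℝ) := by
        refine Finset.sum_le_sum fun q hq => ?_
        rw [intervalIntegral.integral_const_mul]
        have hq0 : 0 < q := (Finset.mem_Icc.1 hq).1
        have hq' : (0 : ℝ) < q := by exact_mod_cast hq0
        calc _ ≤ (2 ^ j / q : ℝ) * (2 * (1 / 2 ^ j)) := by
              gcongr
              exact integral_indicator_nearInt_mul_le (by positivity) hq0 s
          _ = 2 * (1 / q : ℝ) := by field_simp
    _ ≤ 2 * (1 + j) := by
        rw [← Finset.mul_sum]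
        linarith [sum_Icc_one_div_le j]

lemma intervalIntegrable_rotationBound (J : ℕ) (s : ℝ) :
    IntervalIntegrable (fun x => rotationBound J (x + s)) volume 0 1 := by
  unfold rotationBound
  apply IntervalIntegrable.add intervalIntegrable_const
  apply intervalIntegrable_finset_sum
  intro j _
  exact (intervalIntegrable_dirichletWeight j s).const_mul _

lemma integral_rotationBound_le {J : ℕ} (hJ : 1 ≤ J) (s : ℝ) :
    ∫ x in (0 : ℝ)..1, rotationBound J (x + s) ≤ 13 * (J : ℝ) ^ 2 := by
  unfold rotationBound
  rw [intervalIntegral.integral_add intervalIntegrable_const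
    (intervalIntegrable_finset_sum _ fun j _ => (intervalIntegrable_dirichletWeight j s).const_mul _),
    intervalIntegral.integral_finsetSum
      fun j _ => (intervalIntegrable_dirichletWeight j s).const_mul _]
  have hJ' : (1 : ℝ) ≤ J := by exact_mod_cast hJ
  have h : ∑ j ∈ Finset.range J, ∫ x in (0 : ℝ)..1, 6 * dirichletWeight j (x + s)
      ≤ ∑ _j ∈ Finset.range J, 12 * (J : ℝ) := by
    refine Finset.sum_le_sum fun j hj => ?_
    rw [intervalIntegral.integral_const_mul]
    have h1 : (j : ℝ) + 1 ≤ J := by exact_mod_cast Finset.mem_range.1 hj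
    linarith [integral_dirichletWeight_le j s]
  simp only [Finset.sum_const, Finset.card_range, nsmul_eq_mul] at h
  simp only [intervalIntegral.integral_const, smul_eq_mul]
  nlinarith

/-- For finitely many shifts there is a rotation that is simultaneously good for all of them. -/
lemma exists_rotationBound_le {ι : Type*} (T : Finset ι) (s : ι → ℝ) {J : ℕ} (hJ : 1 ≤ J) :
    ∃ α : ℝ, ∀ k ∈ T, rotationBound J (α + s k) ≤ T.card * (13 * (J : ℝ) ^ 2) := by
  by_contra! hcon
  have hint : IntervalIntegrable (fun x => ∑ k ∈ T, rotationBound J (x + s k)) volume 0 1 :=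
    intervalIntegrable_finset_sum _ fun k _ => intervalIntegrable_rotationBound J (s k)
  have h1 : ∫ x in (0 : ℝ)..1, ∑ k ∈ T, rotationBound J (x + s k)
      ≤ T.card * (13 * (J : ℝ) ^ 2) := by
    rw [intervalIntegral.integral_finsetSum fun k _ => intervalIntegrable_rotationBound J (s k)]
    rw [← nsmul_eq_mul]
    exact Finset.sum_le_card_nsmul _ _ _ fun k _ => integral_rotationBound_le hJ (s k)
  have h2 : ∀ x : ℝ, T.card * (13 * (J : ℝ) ^ 2) < ∑ k ∈ T, rotationBound J (x + s k) := by
    intro x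
    obtain ⟨k, hk, hlt⟩ := hcon x
    exact hlt.trans_le (Finset.single_le_sum (f := fun k => rotationBound J (x + s k))
      (fun k _ => by linarith [one_le_rotationBound J (x + s k)]) hk)
  have h3 := intervalIntegral.intervalIntegral_pos_of_pos_on
    (hint.sub (intervalIntegrable_const (c := T.card * (13 * (J : ℝ) ^ 2))))
    (fun x _ => sub_pos.2 (h2 x)) zero_lt_one
  rw [intervalIntegral.integral_sub hint intervalIntegrable_const] at h3
  simp only [intervalIntegral.integral_const, smul_eq_mul] at h3
  linarith

lemma indicator_fract_le {t l u : ℝ} (hlu : l ≤ u) :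
    (if l ≤ Int.fract t ∧ Int.fract t ≤ u then (1 : ℝ) else 0)
      ≤ (u - l) - saw (t - l) - saw (u - t) := by
  have e : (u - l) - saw (t - l) - saw (u - t) = ((⌊t - l⌋ + ⌊u - t⌋ + 1 : ℤ) : ℝ) := by
    simp only [saw, Int.fract]; push_cast; ring
  rw [e]
  have h1 := Int.lt_floor_add_one (t - l)
  have h2 := Int.lt_floor_add_one (u - t)
  split_ifs with h
  · have hf : t = ⌊t⌋ + Int.fract t := (Int.floor_add_fract t).symm
    have h3 : ⌊t⌋ ≤ ⌊t - l⌋ := Int.le_floor.2 (by linarith [h.1])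
    have h4 : -⌊t⌋ ≤ ⌊u - t⌋ := Int.le_floor.2 (by push_cast; linarith [h.2])
    exact_mod_cast (show (1 : ℤ) ≤ ⌊t - l⌋ + ⌊u - t⌋ + 1 by lia)
  · have h3 : (-1 : ℝ) < ((⌊t - l⌋ + ⌊u - t⌋ + 1 : ℤ) : ℝ) := by push_cast; linarith
    have h4 : (-1 : ℤ) < ⌊t - l⌋ + ⌊u - t⌋ + 1 := by exact_mod_cast h3
    exact_mod_cast (show (0 : ℤ) ≤ ⌊t - l⌋ + ⌊u - t⌋ + 1 by lia)

lemma le_indicator_fract {t l u : ℝ} (hl : 0 ≤ l) (hu : u ≤ 1) :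
    (u - l) - saw (t - l) + saw (t - u)
      ≤ (if l ≤ Int.fract t ∧ Int.fract t ≤ u then (1 : ℝ) else 0) := by
  have e : (u - l) - saw (t - l) + saw (t - u) = ((⌊t - l⌋ - ⌊t - u⌋ : ℤ) : ℝ) := by
    simp only [saw, Int.fract]; push_cast; ring
  rw [e]
  have hf : t = ⌊t⌋ + Int.fract t := (Int.floor_add_fract t).symm
  have h0 := Int.fract_nonneg t
  have h1 := Int.fract_lt_one t
  have h2 : ⌊t - l⌋ ≤ ⌊t⌋ := Int.floor_le_floor (by linarith)
  have h3 : ⌊t⌋ - 1 ≤ ⌊t - u⌋ := Int.le_floor.2 (by push_cast; linarith)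
  split_ifs with h
  · exact_mod_cast (show ⌊t - l⌋ - ⌊t - u⌋ ≤ 1 by lia)
  · have h4 : ⌊t - l⌋ - ⌊t - u⌋ ≤ 0 := by
      rcases not_and_or.1 h with h | h
      · have : ⌊t - l⌋ < ⌊t⌋ := Int.floor_lt.2 (by linarith)
        lia
      · have : ⌊t⌋ ≤ ⌊t - u⌋ := Int.le_floor.2 (by linarith)
        lia
    exact_mod_cast h4

lemma abs_card_filter_fract_sub_le (S : Finset ℕ) (t l u : ℕ → ℝ) {E : ℝ}
    (h : ∀ i ∈ S, 0 ≤ l i ∧ l i ≤ u i ∧ u i ≤ 1)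
    (hl : |∑ i ∈ S, saw (t i - l i)| ≤ E) (hu : |∑ i ∈ S, saw (t i - u i)| ≤ E)
    (hu' : |∑ i ∈ S, saw (u i - t i)| ≤ E) :
    |((S.filter fun i => l i ≤ Int.fract (t i) ∧ Int.fract (t i) ≤ u i).card : ℝ)
      - ∑ i ∈ S, (u i - l i)| ≤ 2 * E := by
  rw [Finset.card_filter]
  push_cast
  have h1 := Finset.sum_le_sum fun i hi => indicator_fract_le (t := t i) (h i hi).2.1
  have h2 := Finset.sum_le_sum fun i hi =>
    le_indicator_fract (t := t i) (h i hi).1 (h i hi).2.2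
  rw [Finset.sum_sub_distrib, Finset.sum_sub_distrib] at h1
  rw [Finset.sum_add_distrib, Finset.sum_sub_distrib] at h2
  rw [abs_le] at hl hu hu' ⊢
  constructor <;> linarith

/-- The `N`-point set consisting of the points `(i / N, {i α})`, `0 ≤ i < N`. -/
def kroneckerSet (N : ℕ) (α : ℝ) : Finset (ℝ × ℝ) :=
  (Finset.range N).image fun i : ℕ => ((i : ℝ) / N, Int.fract (i * α))

lemma injOn_kronecker (N : ℕ) (α : ℝ) :
    Set.InjOn (fun i : ℕ => ((i : ℝ) / N, Int.fract (i * α))) (Finset.range N) := by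
  intro i hi i' _ h
  have hN : (N : ℝ) ≠ 0 := by
    have : i < N := by simpa using hi
    exact_mod_cast (by lia : N ≠ 0)
  have h1 := congrArg Prod.fst h
  simp only at h1
  rw [div_left_inj' hN] at h1
  exact_mod_cast h1

lemma card_kroneckerSet (N : ℕ) (α : ℝ) : (kroneckerSet N α).card = N := by
  rw [kroneckerSet, Finset.card_image_of_injOn (injOn_kronecker N α), Finset.card_range]

lemma kroneckerSet_subset (N : ℕ) (α : ℝ) : (kroneckerSet N α : Set (ℝ × ℝ)) ⊆ unitSq := by
  intro x hx
  simp only [kroneckerSet, Finset.coe_image, Set.mem_image, Finset.coe_range, Set.mem_Iio] at hx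
  obtain ⟨i, hi, rfl⟩ := hx
  have hi' : (i : ℝ) ≤ N := by exact_mod_cast hi.le
  exact ⟨⟨by positivity, div_le_one_of_le₀ hi' (by positivity)⟩,
    ⟨Int.fract_nonneg _, (Int.fract_lt_one _).le⟩⟩

open Classical in
lemma ncard_kroneckerSet_inter (N : ℕ) (α : ℝ) (R : Set (ℝ × ℝ)) :
    ((kroneckerSet N α : Set (ℝ × ℝ)) ∩ R).ncard =
      ((Finset.range N).filter fun i : ℕ => ((i : ℝ) / N, Int.fract (i * α)) ∈ R).card := by
  have : (kroneckerSet N α : Set (ℝ × ℝ)) ∩ R =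
      (((Finset.range N).filter fun i : ℕ => ((i : ℝ) / N, Int.fract (i * α)) ∈ R).image
        fun i : ℕ => ((i : ℝ) / N, Int.fract (i * α)) : Finset (ℝ × ℝ)) := by
    ext x
    simp only [kroneckerSet, Finset.coe_image, Finset.coe_filter, Set.mem_inter_iff,
      Set.mem_image, Set.mem_ofPred_eq, Finset.mem_coe]
    constructor
    · rintro ⟨⟨i, hi, rfl⟩, hR⟩
      exact ⟨i, ⟨hi, hR⟩, rfl⟩
    · rintro ⟨i, ⟨hi, hR⟩, rfl⟩
      exact ⟨⟨i, hi, rfl⟩, hR⟩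
  rw [this, Set.ncard_coe_finset, Finset.card_image_of_injOn]
  exact (injOn_kronecker N α).mono (Finset.coe_subset.2 (Finset.filter_subset _ _))

section RiemannSum

variable {g : ℝ → ℝ}

lemma MonotoneOn.abs_sum_Ico_sub_integral_le {a b : ℕ} (hab : a ≤ b)
    (hg : MonotoneOn g (Set.Icc a b)) (h0 : ∀ x, 0 ≤ g x) (h1 : ∀ x, g x ≤ 1) :
    |∑ i ∈ Finset.Ico a b, g i - ∫ x in (a : ℝ)..b, g x| ≤ 1 := by
  have h2 := hg.sum_le_integral_Ico hab
  have h3 := hg.integral_le_sum_Ico hab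
  have h4 := Finset.sum_Ico_sub (fun i : ℕ => g i) hab
  rw [Finset.sum_sub_distrib] at h4
  rw [abs_le]
  constructor <;> linarith [h0 a, h1 b]

lemma AntitoneOn.abs_sum_Ico_sub_integral_le {a b : ℕ} (hab : a ≤ b)
    (hg : AntitoneOn g (Set.Icc a b)) (h0 : ∀ x, 0 ≤ g x) (h1 : ∀ x, g x ≤ 1) :
    |∑ i ∈ Finset.Ico a b, g i - ∫ x in (a : ℝ)..b, g x| ≤ 1 := by
  have h2 := hg.sum_le_integral_Ico hab
  have h3 := hg.integral_le_sum_Ico hab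
  have h4 := Finset.sum_Ico_sub (fun i : ℕ => g i) hab
  rw [Finset.sum_sub_distrib] at h4
  rw [abs_le]
  constructor <;> linarith [h0 b, h1 a]

/-- Riemann sums of a unimodal function with values in `[0, 1]`. -/
lemma abs_sum_range_sub_integral_le {N : ℕ} {m : ℝ} (hm0 : 0 ≤ m) (hmN : m ≤ N)
    (h0 : ∀ x, 0 ≤ g x) (h1 : ∀ x, g x ≤ 1)
    (hmono : MonotoneOn g (Set.Icc 0 m)) (hanti : AntitoneOn g (Set.Icc m N)) :
    |∑ i ∈ Finset.range N, g i - ∫ x in (0 : ℝ)..N, g x| ≤ 3 := by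
  have hint : IntervalIntegrable g volume 0 N :=
    (MonotoneOn.intervalIntegrable (by rwa [Set.uIcc_of_le hm0])).trans
      (AntitoneOn.intervalIntegrable (by rwa [Set.uIcc_of_le hmN]) : IntervalIntegrable g volume m N)
  set j := ⌊m⌋₊
  have hjm : (j : ℝ) ≤ m := Nat.floor_le hm0
  have hmj : m < j + 1 := Nat.lt_floor_add_one m
  have hjN : j ≤ N := by exact_mod_cast hjm.trans hmN
  have hA : |∑ i ∈ Finset.Ico 0 j, g i - ∫ x in (0 : ℝ)..j, g x| ≤ 1 := by
    have := MonotoneOn.abs_sum_Ico_sub_integral_le (g := g) (a := 0) (b := j) (Nat.zero_le _)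
      (hmono.mono (Set.Icc_subset_Icc (by simp) hjm)) h0 h1
    simpa using this
  rcases hjN.eq_or_lt with h | h
  · rw [← h, Finset.range_eq_Ico]
    linarith
  · have hsub : ∀ a b : ℝ, 0 ≤ a → a ≤ b → b ≤ N → IntervalIntegrable g volume a b := by
      intro a b ha hab hb
      refine hint.mono_set ?_
      rw [Set.uIcc_of_le hab, Set.uIcc_of_le (ha.trans (hab.trans hb))]
      exact Set.Icc_subset_Icc ha hb
    have hjN' : (j : ℝ) + 1 ≤ N := by exact_mod_cast h
    have hj0 : (0 : ℝ) ≤ j := by positivity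
    have hB : |∑ i ∈ Finset.Ico (j + 1) N, g i - ∫ x in (j + 1 : ℝ)..N, g x| ≤ 1 := by
      have := AntitoneOn.abs_sum_Ico_sub_integral_le (g := g) (a := j + 1) (b := N) h
        (hanti.mono (Set.Icc_subset_Icc (by push_cast; exact hmj.le) le_rfl)) h0 h1
      simpa using this
    have i1 := hsub 0 j le_rfl hj0 (by linarith)
    have i2 := hsub j (j + 1) hj0 (by linarith) hjN'
    have i3 := hsub (j + 1) N (by linarith) hjN' le_rfl
    have hC0 : 0 ≤ ∫ x in (j : ℝ)..(j + 1), g x :=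
      intervalIntegral.integral_nonneg (by linarith) fun x _ => h0 x
    have hC1 : ∫ x in (j : ℝ)..(j + 1), g x ≤ 1 := by
      have := intervalIntegral.integral_mono_on (by linarith) i2
        (intervalIntegrable_const (c := (1 : ℝ))) fun x _ => h1 x
      simpa using this
    have hsplit : ∑ i ∈ Finset.range N, g i =
        ∑ i ∈ Finset.Ico 0 j, g i + g j + ∑ i ∈ Finset.Ico (j + 1) N, g i := by
      rw [Finset.range_eq_Ico, ← Finset.sum_Ico_consecutive (fun i : ℕ => g i) (Nat.zero_le j) hjN,
        Finset.sum_eq_sum_Ico_succ_bot h]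
      ring
    rw [hsplit, ← intervalIntegral.integral_add_adjacent_intervals i1 (i2.trans i3),
      ← intervalIntegral.integral_add_adjacent_intervals i2 i3]
    rw [abs_le] at hA hB ⊢
    constructor <;> linarith [h0 j, h1 j]

end RiemannSum

lemma abs_sum_div_sub_integral_le {f : ℝ → ℝ} {N : ℕ} (hN : 0 < N) {m : ℝ}
    (hm : m ∈ Set.Icc (0 : ℝ) 1) (h0 : ∀ x, 0 ≤ f x) (h1 : ∀ x, f x ≤ 1)
    (hmono : MonotoneOn f (Set.Icc 0 m)) (hanti : AntitoneOn f (Set.Icc m 1)) :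
    |∑ i ∈ Finset.range N, f (i / N) - N * ∫ x in (0 : ℝ)..1, f x| ≤ 3 := by
  have hN' : (0 : ℝ) < N := by exact_mod_cast hN
  have h := abs_sum_range_sub_integral_le (g := fun x => f (x / N)) (N := N) (m := m * N)
    (by have := hm.1; positivity) (mul_le_of_le_one_left hN'.le hm.2) (fun x => h0 _)
    (fun x => h1 _) ?_ ?_
  · rwa [intervalIntegral.integral_comp_div _ hN'.ne', zero_div, div_self hN'.ne',
      smul_eq_mul] at h
  · intro x hx y hy hxy
    refine hmono ⟨div_nonneg hx.1 hN'.le, (div_le_iff₀ hN').2 hx.2⟩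
      ⟨div_nonneg hy.1 hN'.le, (div_le_iff₀ hN').2 hy.2⟩ (by gcongr)
  · intro x hx y hy hxy
    refine hanti ⟨(le_div_iff₀ hN').2 hx.1, (div_le_one hN').2 hx.2⟩
      ⟨(le_div_iff₀ hN').2 hy.1, (div_le_one hN').2 hy.2⟩ (by gcongr)

open Classical in
/-- Indices of the columns `x = i / N` that meet `J`. -/
def columns (N : ℕ) (J : Set ℝ) : Finset ℕ := (Finset.range N).filter fun i => (i / N : ℝ) ∈ J

/-- Discrepancy of the Kronecker set for the region between two graphs. -/
lemma abs_discrepancy_region_le {N : ℕ} (hN : 0 < N) {α E m : ℝ} {R : Set (ℝ × ℝ)} {J : Set ℝ}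
    {l u : ℝ → ℝ} (hJ : MeasurableSet J) (hl : Measurable l) (hu : Measurable u)
    (hR : ∀ x y, (x, y) ∈ R ↔ x ∈ J ∧ l x ≤ y ∧ y ≤ u x) (hlu : ∀ x ∈ J, l x ≤ u x)
    (hsub : R ⊆ unitSq) (hm : m ∈ Set.Icc (0 : ℝ) 1)
    (hmono : MonotoneOn (J.indicator (u - l)) (Set.Icc 0 m))
    (hanti : AntitoneOn (J.indicator (u - l)) (Set.Icc m 1))
    (hEl : |∑ i ∈ columns N J, saw (i * α - l (i / N))| ≤ E)
    (hEu : |∑ i ∈ columns N J, saw (i * α - u (i / N))| ≤ E)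
    (hEu' : |∑ i ∈ columns N J, saw (u (i / N) - i * α)| ≤ E) :
    |(((kroneckerSet N α : Set (ℝ × ℝ)) ∩ R).ncard : ℝ) - N * (volume R).toReal|
      ≤ 2 * E + 3 := by
  classical
  set f := J.indicator (u - l)
  have hlow : ∀ x ∈ J, x ∈ Set.Icc (0 : ℝ) 1 ∧ 0 ≤ l x := fun x hx =>
    have h := hsub ((hR x (l x)).2 ⟨hx, le_rfl, hlu x hx⟩)
    ⟨h.1, h.2.1⟩
  have hupp : ∀ x ∈ J, u x ≤ 1 := fun x hx =>
    (hsub ((hR x (u x)).2 ⟨hx, hlu x hx, le_rfl⟩)).2.2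
  have hf0 : ∀ x, 0 ≤ f x := Set.indicator_nonneg fun x hx => sub_nonneg.2 (hlu x hx)
  have hf1 : ∀ x, f x ≤ 1 := Set.indicator_le' (fun x hx => by
    have := hlow x hx
    have := hupp x hx
    simp only [Pi.sub_apply]; linarith) fun _ _ => zero_le_one
  have hfm : Measurable f := (hu.sub hl).indicator hJ
  have hRm : MeasurableSet R := by
    have : R = {z | z.1 ∈ J ∧ l z.1 ≤ z.2 ∧ z.2 ≤ u z.1} := by
      ext ⟨x, y⟩; exact hR x y
    rw [this]
    exact (measurable_fst hJ).inter ((measurableSet_le (hl.comp measurable_fst)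
      measurable_snd).inter (measurableSet_le measurable_snd (hu.comp measurable_fst)))
  have hvol : (volume R).toReal = ∫ x in (0 : ℝ)..1, f x := by
    have h1 : ∫ x in (0 : ℝ)..1, f x = ∫ x, f x := by
      rw [intervalIntegral.integral_of_le zero_le_one, ← integral_Icc_eq_integral_Ioc]
      exact setIntegral_eq_integral_of_forall_compl_eq_zero fun x hx =>
        Set.indicator_of_notMem (fun h => hx (hlow x h).1) _
    rw [h1, integral_eq_lintegral_of_nonneg_ae (Filter.Eventually.of_forall hf0)
      hfm.aestronglyMeasurable, Measure.volume_eq_prod, Measure.prod_apply hRm]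
    congr 2
    ext x
    by_cases hx : x ∈ J
    · have : Prod.mk x ⁻¹' R = Set.Icc (l x) (u x) := by
        ext y; simp [hR, hx]
      rw [this, Real.volume_Icc]
      simp [f, hx]
    · have : Prod.mk x ⁻¹' R = ∅ := by
        ext y; simp [hR, hx]
      simp [this, f, hx]
  have hsum : ∑ i ∈ columns N J, (u (i / N) - l (i / N)) = ∑ i ∈ Finset.range N, f (i / N) := by
    rw [columns, Finset.sum_filter]
    exact Finset.sum_congr rfl fun i _ => by simp [f, Set.indicator_apply]
  have hcount : ((kroneckerSet N α : Set (ℝ × ℝ)) ∩ R).ncard = ((columns N J).filter fun i : ℕ =>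
      l (i / N) ≤ Int.fract (i * α) ∧ Int.fract (i * α) ≤ u (i / N)).card := by
    rw [ncard_kroneckerSet_inter, columns, Finset.filter_filter]
    simp_rw [hR]
  have h1 := abs_card_filter_fract_sub_le (columns N J) (fun i => i * α) (fun i => l (i / N))
    (fun i => u (i / N)) (fun i hi => by
      have hx := (Finset.mem_filter.1 hi).2
      exact ⟨(hlow _ hx).2, hlu _ hx, hupp _ hx⟩) hEl hEu hEu'
  have h2 := abs_sum_div_sub_integral_le hN hm hf0 hf1 hmono hanti
  rw [hsum, ← hcount] at h1
  rw [hvol]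
  rw [abs_le] at h1 h2 ⊢
  constructor <;> linarith

/-- The sawtooth sums along segments of slope `σ` inside the unit square are bounded by `E`. -/
def SlopeBound (N : ℕ) (α σ E : ℝ) : Prop :=
  ∀ S ⊆ Finset.range N, (S : Set ℕ).OrdConnected → ∀ κ : ℝ,
    (∀ i ∈ S, κ + σ * (i / N) ∈ Set.Icc (0 : ℝ) 1) →
    |∑ i ∈ S, saw (i * α - (κ + σ * (i / N)))| ≤ E ∧
    |∑ i ∈ S, saw (κ + σ * (i / N) - i * α)| ≤ E

lemma SlopeBound.mono {N : ℕ} {α σ E E' : ℝ} (h : SlopeBound N α σ E) (hE : E ≤ E') :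
    SlopeBound N α σ E' := fun S hS hc κ hκ =>
  ⟨(h S hS hc κ hκ).1.trans hE, (h S hS hc κ hκ).2.trans hE⟩

lemma slopeBound_rotationBound {N J : ℕ} (hN : N ≤ 2 ^ J) (α σ : ℝ) :
    SlopeBound N α σ (rotationBound J (α + -(σ / N))) := by
  intro S hS hc κ _
  constructor
  · convert abs_sum_saw_le_of_ordConnected hN (α + -(σ / N)) (-κ) hS hc using 4
    ring
  · convert abs_sum_saw_neg_le_of_ordConnected hN (α + -(σ / N)) κ hS hc using 4
    ring

/-- Almost horizontal segments. -/
lemma slopeBound_of_abs_le {N J : ℕ} (hN : N ≤ 2 ^ J) (α : ℝ) {σ : ℝ} (hσ : |σ| ≤ 1 / N) :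
    SlopeBound N α σ (rotationBound J α + 2) := by
  intro S hS hc κ _
  have hcard : (S.card : ℝ) ≤ N := by
    exact_mod_cast (Finset.card_le_card hS).trans (Finset.card_range N).le
  have hε : 2 * (1 / N : ℝ) * S.card ≤ 2 := by
    rcases Nat.eq_zero_or_pos N with rfl | hpos
    · simp
    · have : (0 : ℝ) < N := by exact_mod_cast hpos
      calc 2 * (1 / N : ℝ) * S.card ≤ 2 * (1 / N : ℝ) * N := by gcongr
        _ = 2 := by field_simp
  have hx : ∀ i ∈ S, |σ * (i / N)| ≤ 1 / N := by
    intro i hi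
    have hi' : (i : ℝ) ≤ N := by exact_mod_cast (Finset.mem_range.1 (hS hi)).le
    have h1 : (i / N : ℝ) ≤ 1 := div_le_one_of_le₀ hi' (by positivity)
    have h0 : (0 : ℝ) ≤ i / N := by positivity
    rw [abs_mul, abs_of_nonneg h0]
    exact (mul_le_of_le_one_right (abs_nonneg _) h1).trans hσ
  constructor
  · have := abs_sum_saw_le_of_close S (fun i => i * α - (κ + σ * (i / N)))
      (fun i => i * α + -κ) (ε := 1 / N) (B := rotationBound J α)
      (fun i hi => by
        have e : i * α - (κ + σ * (i / N)) - (i * α + -κ) = -(σ * (i / N)) := by ring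
        rw [e, abs_neg]; exact hx i hi)
      (fun γ => by
        simpa only [add_assoc] using abs_sum_saw_le_of_ordConnected hN α (-κ + γ) hS hc)
    linarith
  · have := abs_sum_saw_le_of_close S (fun i => κ + σ * (i / N) - i * α)
      (fun i => -(i * α) + κ) (ε := 1 / N) (B := rotationBound J α)
      (fun i hi => by
        have e : κ + σ * (i / N) - i * α - (-(i * α) + κ) = σ * (i / N) := by ring
        rw [e]; exact hx i hi)
      (fun γ => by
        simpa only [add_assoc] using abs_sum_saw_neg_le_of_ordConnected hN α (κ + γ) hS hc)
    linarith

/-- Almost vertical segments meet at most two columns. -/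
lemma slopeBound_of_le_abs {N : ℕ} (α : ℝ) {σ : ℝ} (hσ : (N : ℝ) ≤ |σ|) :
    SlopeBound N α σ 1 := by
  intro S hS hc κ hκ
  have hcard : S.card ≤ 2 := by
    rcases S.eq_empty_or_nonempty with rfl | hne
    · simp
    have hmin := S.min'_mem hne
    have hmax := S.max'_mem hne
    have hN : (0 : ℝ) < N := by
      have := Finset.mem_range.1 (hS hmin)
      exact_mod_cast (by lia : 0 < N)
    have hle : (S.max' hne : ℝ) ≤ S.min' hne + 1 := by
      have h1 := hκ _ hmin
      have h2 := hκ _ hmax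
      have h3 : |σ * (S.max' hne / N) - σ * (S.min' hne / N)| ≤ 1 := by
        rw [abs_le]; constructor <;> linarith [h1.1, h1.2, h2.1, h2.2]
      rw [← mul_sub, ← sub_div, abs_mul] at h3
      by_contra! hcon
      have h4 : (1 : ℝ) / N < |((S.max' hne : ℝ) - S.min' hne) / N| := by
        refine lt_of_lt_of_le ?_ (le_abs_self _)
        gcongr
        linarith
      have h5 : (1 : ℝ) < N * |((S.max' hne : ℝ) - S.min' hne) / N| := by
        calc (1 : ℝ) = N * (1 / N) := by field_simp
          _ < _ := by gcongr
      linarith [mul_le_mul_of_nonneg_right hσ (abs_nonneg (((S.max' hne : ℝ) - S.min' hne) / N))]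
    have hle' : S.max' hne ≤ S.min' hne + 1 := by exact_mod_cast hle
    have hsub : S ⊆ Finset.Icc (S.min' hne) (S.min' hne + 1) := fun i hi =>
      Finset.mem_Icc.2 ⟨S.min'_le i hi, (S.le_max' i hi).trans hle'⟩
    have h := Finset.card_le_card hsub
    rw [Nat.card_Icc] at h
    lia
  have hcard' : (S.card : ℝ) ≤ 2 := by exact_mod_cast hcard
  have key : ∀ x : ℕ → ℝ, |∑ i ∈ S, saw (x i)| ≤ 1 := fun x => by
    refine (Finset.abs_sum_le_sum_abs _ _).trans ?_
    refine (Finset.sum_le_card_nsmul S _ (1 / 2) fun i _ => abs_saw_le _).trans ?_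
    rw [nsmul_eq_mul]; linarith
  exact ⟨key _, key _⟩

/-- Sawtooth sums along the graph of a piecewise linear function with two pieces. -/
lemma abs_sum_saw_piecewise_le {N : ℕ} (hN : 0 < N) {α σ₁ σ₂ κ₁ κ₂ c E : ℝ}
    (h₁ : SlopeBound N α σ₁ E) (h₂ : SlopeBound N α σ₂ E) {J : Set ℝ} (hJ : J.OrdConnected)
    {v : ℝ → ℝ} (hv : ∀ x ∈ J, v x ∈ Set.Icc (0 : ℝ) 1)
    (hv₁ : ∀ x, x ≤ c → v x = κ₁ + σ₁ * x) (hv₂ : ∀ x, c < x → v x = κ₂ + σ₂ * x) :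
    |∑ i ∈ columns N J, saw (i * α - v (i / N))| ≤ 2 * E ∧
    |∑ i ∈ columns N J, saw (v (i / N) - i * α)| ≤ 2 * E := by
  classical
  have hN' : (0 : ℝ) < N := by exact_mod_cast hN
  have hmem : ∀ i, i ∈ columns N J ↔ i < N ∧ (i / N : ℝ) ∈ J := fun i => by simp [columns]
  set S₁ := (columns N J).filter fun i : ℕ => (i / N : ℝ) ≤ c with hS₁
  set S₂ := (columns N J).filter fun i : ℕ => ¬ (i / N : ℝ) ≤ c with hS₂
  have hsub₁ : S₁ ⊆ Finset.range N := fun i hi =>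
    Finset.mem_range.2 ((hmem i).1 (Finset.mem_filter.1 hi).1).1
  have hsub₂ : S₂ ⊆ Finset.range N := fun i hi =>
    Finset.mem_range.2 ((hmem i).1 (Finset.mem_filter.1 hi).1).1
  have hmono : ∀ {i i' : ℕ}, i ≤ i' → (i / N : ℝ) ≤ i' / N := fun h => by gcongr
  have hc₁ : (S₁ : Set ℕ).OrdConnected := by
    refine ⟨fun a ha b hb x hx => ?_⟩
    simp only [hS₁, Finset.coe_filter, Set.mem_ofPred_eq, hmem] at ha hb ⊢
    exact ⟨⟨hx.2.trans_lt hb.1.1, hJ.out ha.1.2 hb.1.2 ⟨hmono hx.1, hmono hx.2⟩⟩,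
      (hmono hx.2).trans hb.2⟩
  have hc₂ : (S₂ : Set ℕ).OrdConnected := by
    refine ⟨fun a ha b hb x hx => ?_⟩
    simp only [hS₂, Finset.coe_filter, Set.mem_ofPred_eq, hmem, not_le] at ha hb ⊢
    exact ⟨⟨hx.2.trans_lt hb.1.1, hJ.out ha.1.2 hb.1.2 ⟨hmono hx.1, hmono hx.2⟩⟩,
      ha.2.trans_le (hmono hx.1)⟩
  have hval₁ : ∀ i ∈ S₁, v (i / N) = κ₁ + σ₁ * (i / N) := fun i hi =>
    hv₁ _ (Finset.mem_filter.1 hi).2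
  have hval₂ : ∀ i ∈ S₂, v (i / N) = κ₂ + σ₂ * (i / N) := fun i hi =>
    hv₂ _ (not_le.1 (Finset.mem_filter.1 hi).2)
  have b₁ := h₁ S₁ hsub₁ hc₁ κ₁ fun i hi => by
    rw [← hval₁ i hi]; exact hv _ ((hmem i).1 (Finset.mem_filter.1 hi).1).2
  have b₂ := h₂ S₂ hsub₂ hc₂ κ₂ fun i hi => by
    rw [← hval₂ i hi]; exact hv _ ((hmem i).1 (Finset.mem_filter.1 hi).1).2
  rw [← Finset.sum_filter_add_sum_filter_not (columns N J) (fun i : ℕ => (i / N : ℝ) ≤ c),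
    ← Finset.sum_filter_add_sum_filter_not (columns N J) (fun i : ℕ => (i / N : ℝ) ≤ c)
      (fun i : ℕ => saw (v (i / N) - i * α)), ← hS₁, ← hS₂,
    Finset.sum_congr rfl fun i hi => by rw [hval₁ i hi],
    Finset.sum_congr (s₁ := S₂) rfl fun i hi => by rw [hval₂ i hi],
    Finset.sum_congr (s₁ := S₁) (f := fun i : ℕ => saw (v (i / N) - i * α)) rfl
      fun i hi => by rw [hval₁ i hi],
    Finset.sum_congr (s₁ := S₂) (f := fun i : ℕ => saw (v (i / N) - i * α)) rfl
      fun i hi => by rw [hval₂ i hi]]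
  constructor
  · exact (abs_add_le _ _).trans (by linarith [b₁.1, b₂.1])
  · exact (abs_add_le _ _).trans (by linarith [b₁.2, b₂.2])

lemma mem_rect_iff {φ : ℝ} {p : ℝ × ℝ} {w h x y : ℝ} :
    (x, y) ∈ rect φ p w h ↔
      ((x - p.1) * Real.cos φ + (y - p.2) * Real.sin φ ∈ Set.Icc 0 w ∧
        -(x - p.1) * Real.sin φ + (y - p.2) * Real.cos φ ∈ Set.Icc 0 h) := by
  have hsc := Real.sin_sq_add_cos_sq φ
  constructor
  · rintro ⟨⟨a, b⟩, ⟨ha, hb⟩, hab⟩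
    obtain ⟨rfl, rfl⟩ := Prod.ext_iff.1 hab
    simp only [rot, Prod.fst_add, Prod.snd_add] at ha hb ⊢
    constructor
    · convert ha using 1; linear_combination a * hsc
    · convert hb using 1; linear_combination b * hsc
  · rintro ⟨ha, hb⟩
    refine ⟨(_, _), ⟨ha, hb⟩, ?_⟩
    ext
    · simp only [rot, Prod.fst_add]; linear_combination (x - p.1) * hsc
    · simp only [rot, Prod.snd_add]; linear_combination (y - p.2) * hsc

lemma abs_discrepancy_rect_pi_div_two_le {N : ℕ} (hN : 0 < N) {α E : ℝ} {p : ℝ × ℝ} {w h : ℝ}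
    (hw : 0 < w) (hh : 0 < h) (hsub : rect (Real.pi / 2) p w h ⊆ unitSq)
    (h₀ : SlopeBound N α 0 E) :
    |(((kroneckerSet N α : Set (ℝ × ℝ)) ∩ rect (Real.pi / 2) p w h).ncard : ℝ)
      - N * (volume (rect (Real.pi / 2) p w h)).toReal| ≤ 4 * E + 3 := by
  set J := Set.Icc (p.1 - h) p.1
  have hR : ∀ x y, (x, y) ∈ rect (Real.pi / 2) p w h ↔
      x ∈ J ∧ (fun _ => p.2 : ℝ → ℝ) x ≤ y ∧ y ≤ (fun _ => p.2 + w : ℝ → ℝ) x := by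
    intro x y
    simp only [mem_rect_iff, Real.cos_pi_div_two, Real.sin_pi_div_two, J, Set.mem_Icc]
    constructor
    · rintro ⟨⟨h1, h2⟩, h3, h4⟩
      refine ⟨⟨?_, ?_⟩, ?_, ?_⟩ <;> linarith
    · rintro ⟨⟨h1, h2⟩, h3, h4⟩
      refine ⟨⟨?_, ?_⟩, ?_, ?_⟩ <;> linarith
  have hy : ∀ x ∈ J, ∀ y, p.2 ≤ y → y ≤ p.2 + w → y ∈ Set.Icc (0 : ℝ) 1 := fun x hx y h1 h2 =>
    (hsub ((hR x y).2 ⟨hx, h1, h2⟩)).2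
  have hm : p.1 ∈ Set.Icc (0 : ℝ) 1 :=
    (hsub ((hR p.1 p.2).2 ⟨⟨by linarith, le_rfl⟩, le_rfl, by linarith⟩)).1
  have bl := abs_sum_saw_piecewise_le (c := 0) (κ₁ := p.2) (κ₂ := p.2) hN h₀ h₀
    (Set.ordConnected_Icc : J.OrdConnected) (v := fun _ => p.2)
    (fun x hx => hy x hx _ le_rfl (by linarith)) (by simp) (by simp)
  have bu := abs_sum_saw_piecewise_le (c := 0) (κ₁ := p.2 + w) (κ₂ := p.2 + w) hN h₀ h₀
    (Set.ordConnected_Icc : J.OrdConnected) (v := fun _ => p.2 + w)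
    (fun x hx => hy x hx _ (by linarith) le_rfl) (by simp) (by simp)
  have := abs_discrepancy_region_le hN measurableSet_Icc measurable_const measurable_const hR
    (fun x _ => by linarith) hsub hm ?_ ?_ bl.1 bu.1 bu.2
  · linarith
  · intro x hx y hy hxy
    by_cases h1 : x ∈ J
    · have h2 : y ∈ J := ⟨h1.1.trans hxy, hy.2⟩
      rw [Set.indicator_of_mem h1, Set.indicator_of_mem h2]
      simp
    · rw [Set.indicator_of_notMem h1]
      exact Set.indicator_nonneg (fun _ _ => by simp [hw.le]) _
  · intro x hx y hy hxy
    by_cases h1 : y ∈ J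
    · have h2 : x ∈ J := ⟨by linarith [hx.1], hxy.trans h1.2⟩
      rw [Set.indicator_of_mem h1, Set.indicator_of_mem h2]
      simp
    · rw [Set.indicator_of_notMem h1]
      exact Set.indicator_nonneg (fun _ _ => by simp [hw.le]) _

lemma min_sub_max_eq (u₁ u₂ l₁ l₂ : ℝ) :
    min u₁ u₂ - max l₁ l₂ =
      min (min (u₁ - l₁) (u₂ - l₂)) (min (u₁ - l₂) (u₂ - l₁)) := by
  grind

lemma abs_discrepancy_rect_le {N : ℕ} (hN : 0 < N) {α E φ : ℝ} {p : ℝ × ℝ} {w h : ℝ}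
    (hφ : φ ∈ Set.Ioo 0 (Real.pi / 2))
    (hw : 0 < w) (hh : 0 < h) (hsub : rect φ p w h ⊆ unitSq)
    (h₁ : SlopeBound N α (Real.tan φ) E) (h₂ : SlopeBound N α (-(Real.tan φ)⁻¹) E) :
    |(((kroneckerSet N α : Set (ℝ × ℝ)) ∩ rect φ p w h).ncard : ℝ)
      - N * (volume (rect φ p w h)).toReal| ≤ 4 * E + 3 := by
  have hs : 0 < Real.sin φ := Real.sin_pos_of_pos_of_lt_pi hφ.1 (by linarith [hφ.2, Real.pi_pos])
  have hc : 0 < Real.cos φ := Real.cos_pos_of_mem_Ioo ⟨by linarith [hφ.1, Real.pi_pos], hφ.2⟩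
  have hsc := Real.sin_sq_add_cos_sq φ
  rw [Real.tan_eq_sin_div_cos] at h₁ h₂
  rw [inv_div] at h₂
  have hmem := fun x y => mem_rect_iff (φ := φ) (p := p) (w := w) (h := h) (x := x) (y := y)
  set s := Real.sin φ
  set c := Real.cos φ
  have ht : 0 < s / c := by positivity
  have ht' : 0 < c / s := by positivity
  set l₁ : ℝ → ℝ := fun x => (p.2 - s / c * p.1) + s / c * x with hl₁
  set l₂ : ℝ → ℝ := fun x => (p.2 + c / s * p.1) + -(c / s) * x with hl₂
  set u₁ : ℝ → ℝ := fun x => (p.2 + h / c - s / c * p.1) + s / c * x with hu₁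
  set u₂ : ℝ → ℝ := fun x => (p.2 + w / s + c / s * p.1) + -(c / s) * x with hu₂
  set a := p.1 - h * s with ha
  set b := p.1 + w * c with hb
  have e11 : ∀ x, u₁ x - l₁ x = h / c := fun x => by simp only [hu₁, hl₁]; ring
  have e22 : ∀ x, u₂ x - l₂ x = w / s := fun x => by simp only [hu₂, hl₂]; ring
  have e12 : ∀ x, u₁ x - l₂ x = (x - a) / (s * c) := fun x => by
    simp only [hu₁, hl₂, ha]; field_simp; linear_combination (x - p.1) * hsc
  have e21 : ∀ x, u₂ x - l₁ x = (b - x) / (s * c) := fun x => by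
    simp only [hu₂, hl₁, hb]; field_simp; linear_combination (p.1 - x) * hsc
  have hwidth : ∀ x, min (u₁ x) (u₂ x) - max (l₁ x) (l₂ x) =
      min (min (h / c) (w / s)) (min ((x - a) / (s * c)) ((b - x) / (s * c))) := fun x => by
    rw [min_sub_max_eq, e11, e22, e12, e21]
  have hscpos : 0 < s * c := by positivity
  have hJ : ∀ x, x ∈ Set.Icc a b ↔ max (l₁ x) (l₂ x) ≤ min (u₁ x) (u₂ x) := fun x => by
    rw [← sub_nonneg (b := max _ _), hwidth]
    simp only [le_min_iff]
    rw [le_div_iff₀ hscpos, le_div_iff₀ hscpos, zero_mul, sub_nonneg, sub_nonneg]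
    have : 0 ≤ h / c := by positivity
    have : 0 ≤ w / s := by positivity
    simp [Set.mem_Icc, *]
  have hR : ∀ x y, (x, y) ∈ rect φ p w h ↔ x ∈ Set.Icc a b ∧
      (fun x => max (l₁ x) (l₂ x)) x ≤ y ∧ y ≤ (fun x => min (u₁ x) (u₂ x)) x := by
    intro x y
    have q1 : l₁ x ≤ y ↔ 0 ≤ -(x - p.1) * s + (y - p.2) * c := by
      have : y - l₁ x = (-(x - p.1) * s + (y - p.2) * c) / c := by
        simp only [hl₁]; field_simp; ring
      rw [← sub_nonneg, this, le_div_iff₀ hc, zero_mul]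
    have q2 : l₂ x ≤ y ↔ 0 ≤ (x - p.1) * c + (y - p.2) * s := by
      have : y - l₂ x = ((x - p.1) * c + (y - p.2) * s) / s := by
        simp only [hl₂]; field_simp; ring
      rw [← sub_nonneg, this, le_div_iff₀ hs, zero_mul]
    have q3 : y ≤ u₁ x ↔ -(x - p.1) * s + (y - p.2) * c ≤ h := by
      have : u₁ x - y = (h - (-(x - p.1) * s + (y - p.2) * c)) / c := by
        simp only [hu₁]; field_simp; ring
      rw [← sub_nonneg, this, le_div_iff₀ hc, zero_mul, sub_nonneg]
    have q4 : y ≤ u₂ x ↔ (x - p.1) * c + (y - p.2) * s ≤ w := by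
      have : u₂ x - y = (w - ((x - p.1) * c + (y - p.2) * s)) / s := by
        simp only [hu₂]; field_simp; ring
      rw [← sub_nonneg, this, le_div_iff₀ hs, zero_mul, sub_nonneg]
    rw [hmem, Set.mem_Icc, Set.mem_Icc, ← q1, ← q2, ← q3, ← q4, hJ]
    simp only [max_le_iff, le_min_iff]
    constructor
    · rintro ⟨⟨h1, h2⟩, h3, h4⟩
      exact ⟨⟨⟨h3.trans h4, h1.trans h4⟩, h3.trans h2, h1.trans h2⟩, ⟨h3, h1⟩, h4, h2⟩
    · rintro ⟨_, ⟨h3, h1⟩, h4, h2⟩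
      exact ⟨⟨h1, h2⟩, h3, h4⟩
  have hlu : ∀ x ∈ Set.Icc a b, (fun x => max (l₁ x) (l₂ x)) x ≤ (fun x => min (u₁ x) (u₂ x)) x :=
    fun x hx => (hJ x).1 hx
  have hvl : ∀ x ∈ Set.Icc a b, max (l₁ x) (l₂ x) ∈ Set.Icc (0 : ℝ) 1 := fun x hx =>
    (hsub ((hR x _).2 ⟨hx, le_rfl, hlu x hx⟩)).2
  have hvu : ∀ x ∈ Set.Icc a b, min (u₁ x) (u₂ x) ∈ Set.Icc (0 : ℝ) 1 := fun x hx =>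
    (hsub ((hR x _).2 ⟨hx, hlu x hx, le_rfl⟩)).2
  have hab : a ≤ b := by
    have : 0 < h * s := by positivity
    have : 0 < w * c := by positivity
    simp only [ha, hb]; linarith
  have hJsub : ∀ x ∈ Set.Icc a b, x ∈ Set.Icc (0 : ℝ) 1 := fun x hx =>
    (hsub ((hR x _).2 ⟨hx, le_rfl, hlu x hx⟩)).1
  have hm : (a + b) / 2 ∈ Set.Icc (0 : ℝ) 1 := hJsub _ ⟨by linarith, by linarith⟩
  have bl := abs_sum_saw_piecewise_le (c := p.1) hN h₂ h₁ (Set.ordConnected_Icc (a := a) (b := b))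
    hvl (κ₁ := p.2 + c / s * p.1) (κ₂ := p.2 - s / c * p.1)
    (fun x hx => max_eq_right (by
      simp only [hl₁, hl₂]
      nlinarith [mul_nonneg ht.le (sub_nonneg.2 hx), mul_nonneg ht'.le (sub_nonneg.2 hx)]))
    (fun x hx => max_eq_left (by
      simp only [hl₁, hl₂]
      nlinarith [mul_nonneg ht.le (sub_nonneg.2 hx.le), mul_nonneg ht'.le (sub_nonneg.2 hx.le)]))
  have hdiff : ∀ x, u₂ x - u₁ x = (a + b - p.1 - x) / (s * c) := fun x => by
    simp only [hu₁, hu₂, ha, hb]; field_simp; linear_combination (p.1 - x) * hsc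
  have bu := abs_sum_saw_piecewise_le (c := a + b - p.1) hN h₁ h₂
    (Set.ordConnected_Icc (a := a) (b := b))
    hvu (κ₁ := p.2 + h / c - s / c * p.1) (κ₂ := p.2 + w / s + c / s * p.1)
    (fun x hx => min_eq_left (by
      rw [← sub_nonneg, hdiff]; exact div_nonneg (by linarith) hscpos.le))
    (fun x hx => min_eq_right (by
      rw [← sub_nonpos, hdiff]; exact div_nonpos_of_nonpos_of_nonneg (by linarith) hscpos.le))
  have hnonneg : ∀ x, 0 ≤ (Set.Icc a b).indicator
      ((fun x => min (u₁ x) (u₂ x)) - fun x => max (l₁ x) (l₂ x)) x :=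
    Set.indicator_nonneg fun x hx => sub_nonneg.2 (hlu x hx)
  have := abs_discrepancy_region_le hN measurableSet_Icc (l := fun x => max (l₁ x) (l₂ x))
    (u := fun x => min (u₁ x) (u₂ x)) (by fun_prop) (by fun_prop) hR
    hlu hsub hm ?_ ?_ bl.1 bu.1 bu.2
  · linarith
  · intro x hx y hy hxy
    by_cases hxJ : x ∈ Set.Icc a b
    · have hyJ : y ∈ Set.Icc a b := ⟨hxJ.1.trans hxy, by linarith [hy.2]⟩
      rw [Set.indicator_of_mem hxJ, Set.indicator_of_mem hyJ]
      simp only [Pi.sub_apply, hwidth]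
      have h1 : (x - a) / (s * c) ≤ (y - a) / (s * c) := by gcongr
      have h2 : (y - a) / (s * c) ≤ (b - y) / (s * c) := by
        gcongr 1
        linarith [hy.2]
      exact min_le_min le_rfl
        (le_min ((min_le_left _ _).trans h1) ((min_le_left _ _).trans (h1.trans h2)))
    · rw [Set.indicator_of_notMem hxJ]
      exact hnonneg y
  · intro x hx y hy hxy
    by_cases hyJ : y ∈ Set.Icc a b
    · have hxJ : x ∈ Set.Icc a b := ⟨by linarith [hx.1], hxy.trans hyJ.2⟩
      rw [Set.indicator_of_mem hxJ, Set.indicator_of_mem hyJ]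
      simp only [Pi.sub_apply, hwidth]
      have h1 : (b - y) / (s * c) ≤ (b - x) / (s * c) := by gcongr
      have h2 : (b - x) / (s * c) ≤ (x - a) / (s * c) := by
        gcongr 1
        linarith [hx.1]
      exact min_le_min le_rfl
        (le_min ((min_le_right _ _).trans (h1.trans h2)) ((min_le_right _ _).trans h1))
    · rw [Set.indicator_of_notMem hyJ]
      exact hnonneg x

lemma tan_le_two_mul {x : ℝ} (h0 : 0 ≤ x) (h1 : x ≤ 1) : Real.tan x ≤ 2 * x := by
  have hc : 1 / 2 ≤ Real.cos x := by nlinarith [Real.one_sub_sq_div_two_le_cos (x := x)]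
  rw [Real.tan_eq_sin_div_cos, div_le_iff₀ (by linarith)]
  nlinarith [Real.sin_le h0]

lemma le_pow_mul_of_lacunary {θ : ℕ → ℝ} {A : ℝ} (hA : 0 ≤ A)
    (hlac : ∀ n, θ (n + 1) ≤ A * θ n) (n : ℕ) : θ n ≤ A ^ n * θ 0 := by
  induction n with
  | zero => simp
  | succ n ih =>
    calc θ (n + 1) ≤ A * θ n := hlac n
      _ ≤ A * (A ^ n * θ 0) := by gcongr
      _ = A ^ (n + 1) * θ 0 := by ring

/-- All but `O(log N)` directions of a lacunary sequence have slope at most `1 / N`. -/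
lemma exists_tan_le_of_lacunary {θ : ℕ → ℝ} {A : ℝ} (hA0 : 0 < A) (hA1 : A < 1)
    (hθ : ∀ n, θ n ∈ Set.Ioc 0 (Real.pi / 2)) (hlac : ∀ n, θ (n + 1) ≤ A * θ n) :
    ∃ c : ℝ, 0 < c ∧ ∀ N : ℕ, 2 ≤ N → ∃ K : ℕ, (K : ℝ) ≤ c * plog N ∧
      ∀ k, K ≤ k → Real.tan (θ k) ≤ 1 / N := by
  have hlogA : 0 < -Real.log A := neg_pos.2 (Real.log_neg hA0 hA1)
  refine ⟨3 / -Real.log A + 1, by positivity, fun N hN => ?_⟩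
  have hN' : (2 : ℝ) ≤ N := by exact_mod_cast hN
  have hp1 : 1 ≤ plog N := le_max_left _ _
  have hlog : Real.log (4 * N) ≤ 3 * plog N := by
    have h1 : Real.logb 2 N ≤ plog N := le_max_right _ _
    have hl2 : 0 < Real.log 2 := Real.log_pos (by norm_num)
    have hl2' : Real.log 2 ≤ 1 := by linarith [Real.log_two_lt_d9]
    have h2 : Real.log N = Real.logb 2 N * Real.log 2 := by
      rw [Real.logb, div_mul_cancel₀ _ hl2.ne']
    have h4 : Real.log 4 = 2 * Real.log 2 := by
      rw [show (4 : ℝ) = 2 ^ 2 by norm_num, Real.log_pow]; norm_num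
    rw [Real.log_mul (by norm_num) (by linarith), h4, h2]
    nlinarith
  refine ⟨⌈Real.log (4 * N) / -Real.log A⌉₊, ?_, fun k hk => ?_⟩
  · have hpos : 0 ≤ Real.log (4 * N) / -Real.log A :=
      div_nonneg (Real.log_nonneg (by linarith)) hlogA.le
    have h1 := (Nat.ceil_lt_add_one hpos).le
    have h2 : Real.log (4 * N) / -Real.log A ≤ 3 * plog N / -Real.log A := by gcongr
    calc _ ≤ 3 * plog N / -Real.log A + 1 := by linarith
      _ ≤ 3 * plog N / -Real.log A + plog N := by linarith
      _ = _ := by ring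
  · have hk' : Real.log (4 * N) ≤ k * -Real.log A :=
      (div_le_iff₀ hlogA).1 (Nat.ceil_le.1 hk)
    have hAk : A ^ k ≤ 1 / (4 * N) := by
      rw [← Real.log_le_log_iff (by positivity) (by positivity), Real.log_pow, one_div,
        Real.log_inv]
      linarith
    have hθk : θ k ≤ 1 / (2 * N) := by
      calc θ k ≤ A ^ k * θ 0 := le_pow_mul_of_lacunary hA0.le hlac k
        _ ≤ 1 / (4 * N) * 2 := by
          gcongr
          · exact (hθ 0).1.le
          · linarith [(hθ 0).2, Real.pi_lt_four]
        _ = 1 / (2 * N) := by field_simp; norm_num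
    have h1 : (1 : ℝ) / (2 * N) ≤ 1 := by
      rw [div_le_one (by positivity)]; linarith
    calc Real.tan (θ k) ≤ 2 * θ k := tan_le_two_mul (hθ k).1.le (hθk.trans h1)
      _ ≤ 2 * (1 / (2 * N)) := by gcongr
      _ = 1 / N := by field_simp

/-- If `Ω = {θ n}` is a lacunary sequence of directions in `(0, π/2]`, then
`D_Ω(N) ≲ (log N)³`: for every `N ≥ 2` there is an `N`-point set `P ⊆ [0,1]²` whose
discrepancy with respect to every rectangle in `A_Ω` contained in `[0,1]²` is at most
`C (log N)³`. -/
theorem directional_discrepancy_lacunary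
    (θ : ℕ → ℝ) (A : ℝ) (hA0 : 0 < A) (hA1 : A < 1)
    (hθ : ∀ n, θ n ∈ Set.Ioc 0 (Real.pi / 2))
    (hlac : ∀ n, θ (n + 1) ≤ A * θ n) :
    ∃ C : ℝ, 0 < C ∧ ∀ N : ℕ, 2 ≤ N →
      ∃ P : Finset (ℝ × ℝ), P.card = N ∧ (P : Set (ℝ × ℝ)) ⊆ unitSq ∧
        ∀ (φ : ℝ) (p : ℝ × ℝ) (w h : ℝ), φ ∈ Set.range θ → 0 < w → 0 < h →
          rect φ p w h ⊆ unitSq →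
          |(((P : Set (ℝ × ℝ)) ∩ rect φ p w h).ncard : ℝ) -
              (N : ℝ) * (volume (rect φ p w h)).toReal| ≤ C * (plog N) ^ 3 := by
  classical
  obtain ⟨c, hc, hK⟩ := exists_tan_le_of_lacunary hA0 hA1 hθ hlac
  refine ⟨4 * ((2 * c + 1) * 52 + 2) + 3, by positivity, fun N hN => ?_⟩
  obtain ⟨K, hKle, hKtan⟩ := hK N hN
  have hNpos : 0 < N := by lia
  have hNpos' : (0 : ℝ) < N := by exact_mod_cast hNpos
  have hp1 : 1 ≤ plog N := le_max_left _ _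
  set J := Nat.clog 2 N
  have hNJ : N ≤ 2 ^ J := Nat.le_pow_clog (by norm_num) N
  have hJ1 : 1 ≤ J := Nat.clog_pos (by norm_num) hN
  have hJle : (J : ℝ) ≤ 2 * plog N := by
    have h1 : (J : ℝ) < Real.logb 2 N + 1 := by
      have := Real.natCeil_logb_natCast 2 N
      have h0 : 0 ≤ Real.logb 2 (N : ℝ) := Real.logb_nonneg (by norm_num) (by exact_mod_cast hNpos)
      have h2 := Nat.ceil_lt_add_one h0
      push_cast at this
      rwa [this] at h2
    linarith [le_max_right 1 (Real.logb 2 N), show plog N = max 1 (Real.logb 2 N) from rfl]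
  let T : Finset ℝ := {0} ∪ (Finset.range K).image (fun k => Real.tan (θ k)) ∪
    (Finset.range K).image (fun k => -(Real.tan (θ k))⁻¹)
  obtain ⟨α, hα⟩ := exists_rotationBound_le T (fun σ => -(σ / N)) hJ1
  have hTcard : (T.card : ℝ) ≤ 2 * K + 1 := by
    have h1 : T.card ≤ 1 + K + K := by
      refine (Finset.card_union_le _ _).trans (add_le_add ((Finset.card_union_le _ _).trans ?_) ?_)
      · refine add_le_add (by simp) ?_
        simpa using Finset.card_image_le (s := Finset.range K) (f := fun k => Real.tan (θ k))
      · simpa using Finset.card_image_le (s := Finset.range K) (f := fun k => -(Real.tan (θ k))⁻¹)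
    have : (T.card : ℝ) ≤ 1 + K + K := by exact_mod_cast h1
    linarith
  have hbound : T.card * (13 * (J : ℝ) ^ 2) ≤ (2 * c + 1) * 52 * plog N ^ 3 := by
    calc T.card * (13 * (J : ℝ) ^ 2) ≤ ((2 * c + 1) * plog N) * (13 * (2 * plog N) ^ 2) := by
          gcongr
          nlinarith
      _ = _ := by ring
  set E := (2 * c + 1) * 52 * plog N ^ 3 + 2
  have hp3 : 1 ≤ plog N ^ 3 := one_le_pow₀ hp1
  have hE1 : 1 ≤ E := by
    have : 0 ≤ (2 * c + 1) * 52 * plog N ^ 3 := by positivity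
    linarith
  have hgood : ∀ σ ∈ T, SlopeBound N α σ E := fun σ hσ =>
    (slopeBound_rotationBound hNJ α σ).mono (by linarith [hα σ hσ])
  have h0T : (0 : ℝ) ∈ T := by simp [T]
  have hα0 : rotationBound J α ≤ (2 * c + 1) * 52 * plog N ^ 3 := by
    have := hα 0 h0T
    simp only [zero_div, neg_zero, add_zero] at this
    exact this.trans hbound
  have hfin : 4 * E + 3 ≤ (4 * ((2 * c + 1) * 52 + 2) + 3) * plog N ^ 3 := by
    simp only [E]; linarith
  refine ⟨kroneckerSet N α, card_kroneckerSet N α, kroneckerSet_subset N α, ?_⟩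
  rintro _ p w h ⟨k, rfl⟩ hw hh hsub
  refine le_trans ?_ hfin
  rcases (hθ k).2.eq_or_lt with hk | hk
  · rw [hk] at hsub ⊢
    exact abs_discrepancy_rect_pi_div_two_le hNpos hw hh hsub (hgood 0 h0T)
  · have htan : 0 < Real.tan (θ k) := Real.tan_pos_of_pos_of_lt_pi_div_two (hθ k).1 hk
    have hslopes : SlopeBound N α (Real.tan (θ k)) E ∧ SlopeBound N α (-(Real.tan (θ k))⁻¹) E := by
      rcases lt_or_ge k K with hkK | hkK
      · have hk' := Finset.mem_range.2 hkK
        refine ⟨hgood _ ?_, hgood _ ?_⟩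
        · exact Finset.mem_union_left _ (Finset.mem_union_right _ (Finset.mem_image_of_mem _ hk'))
        · exact Finset.mem_union_right _ (Finset.mem_image_of_mem _ hk')
      · have h1 := hKtan k hkK
        refine ⟨(slopeBound_of_abs_le hNJ α (by rwa [abs_of_pos htan])).mono (by linarith),
          (slopeBound_of_le_abs α ?_).mono hE1⟩
        rw [abs_neg, abs_of_pos (inv_pos.2 htan)]
        rw [le_inv_comm₀ hNpos' htan]
        simpa using h1
    exact abs_discrepancy_rect_le hNpos ⟨(hθ k).1, hk⟩ hw hh hsub hslopes.1 hslopes.2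

end
end

section
/- Let M ≥ 1 and let Ω ⊆ [0, π/2] satisfy the order-M lacunary covering property. Then there exists a constant C > 0 such that for every N ≥ 2 there is a set P of N points in [0,1]² with the property that for every rectangle R ∈ A_Ω with R ⊆ [0,1]², one has |#(P ∩ R) − N·area(R)| ≤ C (log N)^{2M+1}. In other words, D_Ω(N) ≲ (log N)^{2M+1}. -/
open MeasureTheory

noncomputable section

/-- `Ω` satisfies the order-`M` lacunary covering property: there is a constant `K` such
that for every `0 < δ < 1/2` the set `Ω` can be covered by at most `K (log₂(1/δ))^M`
intervals of length `δ`. -/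
def LacunaryCovering (Ω : Set ℝ) (M : ℕ) : Prop :=
  ∃ K : ℝ, ∀ δ : ℝ, 0 < δ → δ < 1 / 2 →
    ∃ s : Finset ℝ, (s.card : ℝ) ≤ K * (Real.logb 2 (1 / δ)) ^ M ∧
      Ω ⊆ ⋃ x ∈ s, Set.Icc x (x + δ)

/-! ### Sums of integer parts along an arithmetic progression -/

lemma sum_emod_of_isCoprime {p : ℤ} {q : ℕ} (hq : 0 < q) (h : IsCoprime p (q : ℤ)) (m : ℤ) :
    ∑ i ∈ Finset.range q, (m + p * i) % (q : ℤ) = ∑ j ∈ Finset.range q, (j : ℤ) := by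
  have hq' : (q : ℤ) ≠ 0 := by positivity
  have hmaps : Set.MapsTo (fun i : ℕ => ((m + p * i) % (q : ℤ)).toNat)
      (Finset.range q) (Finset.range q) := by
    intro i _
    have h1 := Int.emod_nonneg (m + p * i) hq'
    have h2 := Int.emod_lt_of_pos (m + p * i) (by positivity : (0 : ℤ) < q)
    simp only [Finset.coe_range, Set.mem_Iio]
    omega
  have hinj : Set.InjOn (fun i : ℕ => ((m + p * i) % (q : ℤ)).toNat) (Finset.range q) := by
    intro i hi j hj hij
    simp only [Finset.coe_range, Set.mem_Iio] at hi hj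
    have h1 := Int.emod_nonneg (m + p * i) hq'
    have h2 := Int.emod_nonneg (m + p * j) hq'
    have h3 : (m + p * i) ≡ (m + p * j) [ZMOD (q : ℤ)] := by
      unfold Int.ModEq
      simp only at hij
      omega
    have h4 : (q : ℤ) ∣ p * ((j : ℤ) - i) := by
      have := Int.modEq_iff_dvd.1 h3
      convert this using 1
      ring
    have h6 : (q : ℤ) ∣ (j : ℤ) - i := h.symm.dvd_of_dvd_mul_left h4
    have h7 : (j : ℤ) - i = 0 := Int.eq_zero_of_abs_lt_dvd h6 (by rw [abs_lt]; omega)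
    omega
  refine Finset.sum_nbij _ hmaps hinj
    (Finset.surjOn_of_injOn_of_card_le _ hmaps hinj le_rfl) ?_
  intro i _
  have h1 := Int.emod_nonneg (m + p * i) hq'
  simp [h1]

lemma sum_range_cast_real (n : ℕ) :
    ∑ i ∈ Finset.range n, (i : ℝ) = (n : ℝ) * (n - 1) / 2 := by
  induction n with
  | zero => simp
  | succ k ih => rw [Finset.sum_range_succ, ih]; push_cast; ring

/-- The sum of integer parts over a full period of a rational slope. -/
lemma sum_floor_rat {p : ℤ} {q : ℕ} (hq : 0 < q) (h : IsCoprime p (q : ℤ)) (x : ℝ) :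
    ∑ i ∈ Finset.range q, (⌊x + (p : ℝ) / q * i⌋ : ℝ) =
      ⌊(q : ℝ) * x⌋ + ((p : ℝ) - 1) * (q - 1) / 2 := by
  have hq0 : (q : ℝ) ≠ 0 := by positivity
  have key : ∀ i : ℕ, ⌊x + (p : ℝ) / q * i⌋ = (⌊(q : ℝ) * x⌋ + p * i) / (q : ℤ) := by
    intro i
    have : x + (p : ℝ) / q * i = ((q : ℝ) * x + ((p * i : ℤ) : ℝ)) / (q : ℕ) := by
      push_cast; field_simp
    rw [this, Int.floor_div_natCast, Int.floor_add_intCast]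
  have hmul : ∀ i : ℕ, (q : ℝ) * (⌊x + (p : ℝ) / q * i⌋ : ℝ) =
      ((⌊(q : ℝ) * x⌋ : ℝ) + p * i) - (((⌊(q : ℝ) * x⌋ + p * i) % (q : ℤ) : ℤ) : ℝ) := by
    intro i
    rw [key]
    have := Int.emod_add_mul_ediv (⌊(q : ℝ) * x⌋ + p * i) (q : ℤ)
    have h2 : ((((⌊(q : ℝ) * x⌋ + p * i) % (q : ℤ) : ℤ) : ℝ)) +
        (q : ℝ) * (((⌊(q : ℝ) * x⌋ + p * i) / (q : ℤ) : ℤ) : ℝ) = (⌊(q : ℝ) * x⌋ : ℝ) + p * i := by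
      exact_mod_cast this
    linarith
  have hmod : ∑ i ∈ Finset.range q, (((⌊(q : ℝ) * x⌋ + p * i) % (q : ℤ) : ℤ) : ℝ) =
      (q : ℝ) * (q - 1) / 2 := by
    rw [← sum_range_cast_real, ← Int.cast_sum, sum_emod_of_isCoprime hq h]
    push_cast
    rfl
  have hsum : (q : ℝ) * ∑ i ∈ Finset.range q, (⌊x + (p : ℝ) / q * i⌋ : ℝ) =
      (q : ℝ) * (⌊(q : ℝ) * x⌋ + ((p : ℝ) - 1) * (q - 1) / 2) := by
    rw [Finset.mul_sum, Finset.sum_congr rfl (fun i _ => hmul i), Finset.sum_sub_distrib,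
      Finset.sum_add_distrib, ← Finset.mul_sum, hmod, sum_range_cast_real]
    simp
    ring
  exact mul_left_cancel₀ hq0 hsum

/-- The deviation of `∑ ⌊β + θ i⌋` from its expected value. -/
def floorErr (θ β : ℝ) (n : ℕ) : ℝ :=
  ∑ i ∈ Finset.range n, ((⌊β + θ * i⌋ : ℝ) - (β + θ * i) + 1 / 2)

lemma floorErr_add (θ β : ℝ) (m n : ℕ) :
    floorErr θ β (m + n) = floorErr θ β m + floorErr θ (β + θ * m) n := by
  unfold floorErr
  rw [Finset.sum_range_add]
  congr 1
  refine Finset.sum_congr rfl fun i _ => ?_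
  push_cast
  have : β + θ * ((m : ℝ) + i) = β + θ * m + θ * i := by ring
  rw [this]

lemma abs_floorErr_period_le {θ : ℝ} {p : ℤ} {q : ℕ} (hq : 0 < q) (h : IsCoprime p (q : ℤ))
    (hθ : |θ - (p : ℝ) / q| ≤ 1 / (q : ℝ) ^ 2) (β : ℝ) : |floorErr θ β q| ≤ 2 := by
  have hq0 : (0 : ℝ) < q := by positivity
  have hq1 : (1 : ℝ) ≤ q := by exact_mod_cast hq
  obtain ⟨hl, hu⟩ := abs_le.1 hθ
  have hclose : ∀ i ∈ Finset.range q, |(θ - (p : ℝ) / q) * i| ≤ 1 / q := by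
    intro i hi
    have hi' : (i : ℝ) ≤ q := by exact_mod_cast (Finset.mem_range.1 hi).le
    rw [abs_mul, Nat.abs_cast]
    calc |θ - (p : ℝ) / q| * i ≤ 1 / (q : ℝ) ^ 2 * q := by gcongr
      _ = 1 / q := by field_simp
  have hup : ∑ i ∈ Finset.range q, (⌊β + θ * i⌋ : ℝ) ≤
      ∑ i ∈ Finset.range q, (⌊(β + 1 / q) + (p : ℝ) / q * i⌋ : ℝ) := by
    refine Finset.sum_le_sum fun i hi => ?_
    have := (abs_le.1 (hclose i hi)).2
    exact Int.cast_le.2 (Int.floor_mono (by linarith))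
  have hlo : ∑ i ∈ Finset.range q, (⌊(β - 1 / q) + (p : ℝ) / q * i⌋ : ℝ) ≤
      ∑ i ∈ Finset.range q, (⌊β + θ * i⌋ : ℝ) := by
    refine Finset.sum_le_sum fun i hi => ?_
    have := (abs_le.1 (hclose i hi)).1
    exact Int.cast_le.2 (Int.floor_mono (by linarith))
  rw [sum_floor_rat hq h] at hup hlo
  have e1 : (q : ℝ) * (β + 1 / q) = q * β + 1 := by field_simp
  have e2 : (q : ℝ) * (β - 1 / q) = q * β - 1 := by field_simp
  rw [e1] at hup
  rw [e2] at hlo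
  have f1 := Int.floor_le ((q : ℝ) * β + 1)
  have f2 := Int.lt_floor_add_one ((q : ℝ) * β - 1)
  have hS : floorErr θ β q = ∑ i ∈ Finset.range q, (⌊β + θ * i⌋ : ℝ) -
      (q * β + θ * (q * (q - 1) / 2)) + q / 2 := by
    unfold floorErr
    rw [Finset.sum_add_distrib, Finset.sum_sub_distrib, Finset.sum_add_distrib, ← Finset.mul_sum,
      sum_range_cast_real]
    simp
    ring
  have hd : |θ * (q * (q - 1) / 2) - p * (q - 1) / 2| ≤ 1 / 2 := by
    have : θ * (q * (q - 1) / 2) - p * (q - 1) / 2 = (θ - (p : ℝ) / q) * (q * (q - 1) / 2) := by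
      field_simp
    have h1 : (0 : ℝ) ≤ q * (q - 1) / 2 := by
      have : (0 : ℝ) ≤ q - 1 := by linarith
      positivity
    rw [this, abs_mul, abs_of_nonneg h1]
    calc |θ - (p : ℝ) / q| * (q * (q - 1) / 2) ≤ 1 / (q : ℝ) ^ 2 * (q * q / 2) := by
          gcongr; linarith
      _ = 1 / 2 := by field_simp
  obtain ⟨d1, d2⟩ := abs_le.1 hd
  rw [hS, abs_le]
  constructor <;> linarith

/-- `θ` is badly approximable with constant `ε` by fractions of denominator at most `Q`. -/
def BadlyApprox (θ ε : ℝ) (Q : ℕ) : Prop :=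
  ∀ (q : ℕ) (p : ℤ), 1 ≤ q → q ≤ Q → ε / q ≤ |q * θ - p|

lemma BadlyApprox.neg {θ ε : ℝ} {Q : ℕ} (h : BadlyApprox θ ε Q) : BadlyApprox (-θ) ε Q := by
  intro q p h1 h2
  have := h q (-p) h1 h2
  rw [← abs_neg]
  push_cast at this
  convert this using 2
  ring

lemma abs_floorErr_mul_period_le {θ : ℝ} {q : ℕ} (h : ∀ β, |floorErr θ β q| ≤ 2) (k : ℕ) :
    ∀ β, |floorErr θ β (q * k)| ≤ 2 * k := by
  induction k with
  | zero => intro β; simp [floorErr]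
  | succ k ih =>
    intro β
    rw [Nat.mul_succ, floorErr_add]
    refine (abs_add_le _ _).trans ?_
    have := h (β + θ * ((q * k : ℕ) : ℝ))
    rw [Nat.cast_succ]
    linarith [ih β]

lemma BadlyApprox.abs_floorErr_le {θ ε : ℝ} {Q : ℕ} (h : BadlyApprox θ ε Q) (hε : 0 < ε) :
    ∀ n ≤ Q, ∀ β, |floorErr θ β n| ≤ 2 / ε * (Nat.log 2 n + 1) := by
  intro n
  induction n using Nat.strong_induction_on with
  | _ n ih =>
    intro hn β
    rcases Nat.eq_zero_or_pos n with rfl | hpos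
    · simp [floorErr]; positivity
    obtain ⟨r, hr, hrn⟩ := Real.exists_rat_abs_sub_le_and_den_le θ hpos
    set q := r.den with hqdef
    have hq : 0 < q := r.den_pos
    have hq0 : (0 : ℝ) < q := by positivity
    have hqn : (q : ℝ) ≤ n := by exact_mod_cast hrn
    have hcop : IsCoprime r.num (q : ℤ) := by
      rw [Int.isCoprime_iff_gcd_eq_one]
      exact r.reduced
    have hrr : (r : ℝ) = (r.num : ℝ) / q := by
      exact_mod_cast (Rat.num_div_den r).symm
    rw [hrr] at hr
    have hblock : ∀ β, |floorErr θ β q| ≤ 2 := by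
      refine abs_floorErr_period_le hq hcop (hr.trans ?_)
      rw [sq]
      gcongr
      linarith
    have hcount : (n : ℝ) / q ≤ 1 / ε := by
      have h1 := h q r.num hq (hrn.trans hn)
      have h2 : |q * θ - r.num| = q * |θ - (r.num : ℝ) / q| := by
        rw [← abs_of_pos hq0, ← abs_mul, abs_of_pos hq0]
        congr 1
        field_simp
      have h3 : (q : ℝ) * |θ - (r.num : ℝ) / q| ≤ 1 / (n + 1) := by
        calc (q : ℝ) * |θ - (r.num : ℝ) / q| ≤ q * (1 / ((n + 1) * q)) := by gcongr
          _ = 1 / (n + 1) := by field_simp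
      have h4 : ε / q ≤ 1 / (n + 1) := by linarith
      rw [div_le_div_iff₀ hq0 (by positivity)] at h4
      rw [div_le_div_iff₀ hq0 hε]
      nlinarith
    have hk : ((n / q : ℕ) : ℝ) ≤ 1 / ε := (Nat.cast_div_le).trans hcount
    have hrem : |floorErr θ (β + θ * ((q * (n / q) : ℕ) : ℝ)) (n % q)| ≤
        2 / ε * Nat.log 2 n := by
      rcases Nat.eq_zero_or_pos (n % q) with h0 | h0
      · rw [h0]; simp [floorErr]; positivity
      · have hmod : n % q < q := Nat.mod_lt _ hq
        have hdiv : 1 ≤ n / q := (Nat.one_le_div_iff hq).2 hrn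
        have hsplit := Nat.div_add_mod n q
        have h2 : 2 * (n % q) ≤ n := by nlinarith
        refine (ih (n % q) (by omega) (by omega) _).trans ?_
        have h3 : Nat.log 2 (n % q) + 1 ≤ Nat.log 2 n := by
          rw [← Nat.log_mul_base (by norm_num) h0.ne']
          exact Nat.log_mono_right (by omega)
        gcongr
        exact_mod_cast h3
    have hsum := floorErr_add θ β (q * (n / q)) (n % q)
    rw [Nat.div_add_mod] at hsum
    rw [hsum]
    refine (abs_add_le _ _).trans ?_
    have := abs_floorErr_mul_period_le hblock (n / q) β
    calc _ ≤ 2 * (1 / ε) + 2 / ε * Nat.log 2 n := by linarith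
      _ = _ := by ring

/-! ### Lattice points in parallelograms -/

/-- Lattice points in a wedge between two lines with slopes `σ < τ` crossing at abscissa `r`. -/
lemma abs_wedge_sub_le {σ τ κ E a d r : ℝ} {n : ℕ} (hκ : 0 < κ) (hκd : κ = τ - σ)
    (hσ : ∀ m ≤ n, ∀ β, |floorErr σ β m| ≤ E) (hτ : ∀ m ≤ n, ∀ β, |floorErr τ β m| ≤ E)
    (hr : κ * r = a - d) (hr0 : 0 ≤ r) (hrn : r ≤ n - 1) :
    |∑ i ∈ Finset.range n, ((max (⌊d + τ * i⌋ - ⌊a + σ * i⌋) 0 : ℤ) : ℝ) -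
      κ * ((n - r) ^ 2 - (n - r)) / 2| ≤ 2 * E + κ := by
  set j := ⌈r⌉₊ with hj
  have hjr : r ≤ j := Nat.le_ceil r
  have hjr' : (j : ℝ) < r + 1 := Nat.ceil_lt_add_one hr0
  have hjn : j ≤ n := by
    have : (j : ℝ) < n := by linarith
    exact_mod_cast this.le
  obtain ⟨l, rfl⟩ := Nat.exists_eq_add_of_le hjn
  have hleft : ∑ i ∈ Finset.range j, ((max (⌊d + τ * i⌋ - ⌊a + σ * i⌋) 0 : ℤ) : ℝ) = 0 := by
    refine Finset.sum_eq_zero fun i hi => ?_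
    have h1 : (i : ℝ) < r := Nat.lt_ceil.1 (Finset.mem_range.1 hi)
    have h2 : ⌊d + τ * i⌋ ≤ ⌊a + σ * i⌋ := by
      apply Int.floor_mono
      have : κ * i ≤ κ * r := by gcongr
      rw [hr, hκd] at this
      linarith
    rw [max_eq_right (by omega)]
    simp
  have hright : ∑ i ∈ Finset.range l,
      ((max (⌊d + τ * ((j + i : ℕ) : ℝ)⌋ - ⌊a + σ * ((j + i : ℕ) : ℝ)⌋) 0 : ℤ) : ℝ) =
      floorErr τ (d + τ * j) l - floorErr σ (a + σ * j) l +
        κ * (l * (j - r) + l * (l - 1) / 2) := by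
    have hterm : ∀ i ∈ Finset.range l,
        ((max (⌊d + τ * ((j + i : ℕ) : ℝ)⌋ - ⌊a + σ * ((j + i : ℕ) : ℝ)⌋) 0 : ℤ) : ℝ) =
        ((⌊d + τ * j + τ * i⌋ : ℝ) - (d + τ * j + τ * i) + 1 / 2) -
        ((⌊a + σ * j + σ * i⌋ : ℝ) - (a + σ * j + σ * i) + 1 / 2) +
        (κ * (j - r) + κ * i) := by
      intro i _
      have e1 : d + τ * ((j + i : ℕ) : ℝ) = d + τ * j + τ * i := by push_cast; ring
      have e2 : a + σ * ((j + i : ℕ) : ℝ) = a + σ * j + σ * i := by push_cast; ring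
      rw [e1, e2]
      have h2 : ⌊a + σ * j + σ * i⌋ ≤ ⌊d + τ * j + τ * i⌋ := by
        apply Int.floor_mono
        have h3 : κ * r ≤ κ * (j + i) := by
          gcongr
          have : (0 : ℝ) ≤ i := by positivity
          linarith
        rw [hr, hκd] at h3
        linarith
      rw [max_eq_left (by omega)]
      push_cast
      rw [mul_sub, hr, hκd]
      ring
    have hlin : ∑ i ∈ Finset.range l, (κ * ((j : ℝ) - r) + κ * i) =
        κ * (l * (j - r) + l * (l - 1) / 2) := by
      rw [Finset.sum_add_distrib, ← Finset.mul_sum, ← Finset.mul_sum, sum_range_cast_real]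
      simp
      ring
    rw [Finset.sum_congr rfl hterm, Finset.sum_add_distrib, Finset.sum_sub_distrib, hlin]
    rfl
  rw [Finset.sum_range_add, hleft, hright]
  obtain ⟨b1, b2⟩ := abs_le.1 (hτ l (by omega) (d + τ * j))
  obtain ⟨b3, b4⟩ := abs_le.1 (hσ l (by omega) (a + σ * j))
  set t : ℝ := j - r with ht
  have ht0 : 0 ≤ t := by linarith
  have ht1 : t ≤ 1 := by linarith
  have hmain : κ * (l * t + l * (l - 1) / 2) -
      κ * ((((j + l : ℕ) : ℝ) - r) ^ 2 - (((j + l : ℕ) : ℝ) - r)) / 2 = κ * (t * (1 - t)) / 2 := by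
    have : (((j + l : ℕ) : ℝ) - r) = l + t := by push_cast; linarith
    rw [this]
    ring
  have hp0 : 0 ≤ t * (1 - t) := mul_nonneg ht0 (by linarith)
  have hp1 : t * (1 - t) ≤ 1 := by nlinarith
  have hk0 : 0 ≤ κ * (t * (1 - t)) := by positivity
  have hk1 : κ * (t * (1 - t)) ≤ κ := by nlinarith
  rw [abs_le]
  constructor <;> linarith

/-- Lattice points of a half-open parallelogram in the strip `0 ≤ x < n`. -/
def halfOpenPoints (σ τ a b c d : ℝ) (n : ℕ) : Finset (Σ _ : ℕ, ℤ) :=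
  (Finset.range n).sigma fun i =>
    Finset.Ioc (max ⌊a + σ * i⌋ ⌊c + τ * i⌋) (min ⌊b + σ * i⌋ ⌊d + τ * i⌋)

lemma mem_halfOpenPoints {σ τ a b c d : ℝ} {n i : ℕ} {m : ℤ} :
    (⟨i, m⟩ : Σ _ : ℕ, ℤ) ∈ halfOpenPoints σ τ a b c d n ↔
      i < n ∧ (a + σ * i < m ∧ c + τ * i < m) ∧ ((m : ℝ) ≤ b + σ * i ∧ (m : ℝ) ≤ d + τ * i) := by
  simp [halfOpenPoints, Int.floor_lt, Int.le_floor]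

lemma abs_card_halfOpenPoints_sub_le {σ τ κ E a b c d : ℝ} {n : ℕ} (hκ : 0 < κ)
    (hκd : κ = τ - σ)
    (hσ : ∀ m ≤ n, ∀ β, |floorErr σ β m| ≤ E) (hτ : ∀ m ≤ n, ∀ β, |floorErr τ β m| ≤ E)
    (hab : a ≤ b) (hcd : c ≤ d) (h0 : d ≤ a) (h1 : b - c ≤ κ * (n - 1)) :
    |((halfOpenPoints σ τ a b c d n).card : ℝ) - (b - a) * (d - c) / κ| ≤ 8 * E + 4 * κ := by
  have hcard : ((halfOpenPoints σ τ a b c d n).card : ℝ) =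
      ∑ i ∈ Finset.range n, ((max (⌊d + τ * i⌋ - ⌊a + σ * i⌋) 0 : ℤ) : ℝ) -
      ∑ i ∈ Finset.range n, ((max (⌊d + τ * i⌋ - ⌊b + σ * i⌋) 0 : ℤ) : ℝ) -
      ∑ i ∈ Finset.range n, ((max (⌊c + τ * i⌋ - ⌊a + σ * i⌋) 0 : ℤ) : ℝ) +
      ∑ i ∈ Finset.range n, ((max (⌊c + τ * i⌋ - ⌊b + σ * i⌋) 0 : ℤ) : ℝ) := by
    rw [halfOpenPoints, Finset.card_sigma, ← Finset.sum_sub_distrib, ← Finset.sum_sub_distrib,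
      ← Finset.sum_add_distrib, Nat.cast_sum]
    refine Finset.sum_congr rfl fun i _ => ?_
    rw [Int.card_Ioc]
    have h2 : ⌊a + σ * i⌋ ≤ ⌊b + σ * i⌋ := Int.floor_mono (by linarith)
    have h3 : ⌊c + τ * i⌋ ≤ ⌊d + τ * i⌋ := Int.floor_mono (by linarith)
    generalize ⌊a + σ * i⌋ = A at *
    generalize ⌊b + σ * i⌋ = B at *
    generalize ⌊c + τ * i⌋ = C at *
    generalize ⌊d + τ * i⌋ = D at *
    have : (((min B D - max A C).toNat : ℕ) : ℤ) =
        max (D - A) 0 - max (D - B) 0 - max (C - A) 0 + max (C - B) 0 := by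
      omega
    exact_mod_cast this
  have hw : ∀ x y : ℝ, y ≤ x → x - y ≤ κ * (n - 1) →
      |∑ i ∈ Finset.range n, ((max (⌊y + τ * i⌋ - ⌊x + σ * i⌋) 0 : ℤ) : ℝ) -
        κ * ((n - (x - y) / κ) ^ 2 - (n - (x - y) / κ)) / 2| ≤ 2 * E + κ := by
    intro x y hxy hn
    refine abs_wedge_sub_le hκ hκd hσ hτ (by field_simp) (div_nonneg (by linarith) hκ.le) ?_
    rw [div_le_iff₀ hκ]
    linarith
  obtain ⟨w1, w2⟩ := abs_le.1 (hw a d h0 (by linarith))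
  obtain ⟨w3, w4⟩ := abs_le.1 (hw b d (by linarith) (by linarith))
  obtain ⟨w5, w6⟩ := abs_le.1 (hw a c (by linarith) (by linarith))
  obtain ⟨w7, w8⟩ := abs_le.1 (hw b c (by linarith) (by linarith))
  have harea : κ * ((n - (a - d) / κ) ^ 2 - (n - (a - d) / κ)) / 2 -
      κ * ((n - (b - d) / κ) ^ 2 - (n - (b - d) / κ)) / 2 -
      κ * ((n - (a - c) / κ) ^ 2 - (n - (a - c) / κ)) / 2 +
      κ * ((n - (b - c) / κ) ^ 2 - (n - (b - c) / κ)) / 2 = (b - a) * (d - c) / κ := by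
    field_simp
    ring
  rw [hcard, abs_le]
  constructor <;> linarith

/-- Lattice points of a closed parallelogram contained in the strip `|x| ≤ L - 1`. -/
lemma abs_card_closed_sub_le {σ τ κ E a b c d : ℝ} {L : ℕ} (hκ : 2 ≤ κ) (hκd : κ = τ - σ)
    (hσ : ∀ m ≤ 2 * L + 1, ∀ β, |floorErr σ β m| ≤ E)
    (hτ : ∀ m ≤ 2 * L + 1, ∀ β, |floorErr τ β m| ≤ E)
    (hab : a ≤ b) (hcd : c ≤ d) (h0 : d - a ≤ κ * (L - 1)) (h1 : b - c ≤ κ * (L - 1))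
    (S : Finset (ℤ × ℤ))
    (hS : ∀ z : ℤ × ℤ, z ∈ S ↔ (a + σ * z.1 ≤ z.2 ∧ (z.2 : ℝ) ≤ b + σ * z.1) ∧
      (c + τ * z.1 ≤ z.2 ∧ (z.2 : ℝ) ≤ d + τ * z.1)) :
    |(S.card : ℝ) - (b - a) * (d - c) / κ| ≤ 8 * E + 4 * κ + 1 := by
  have hκ0 : 0 < κ := by linarith
  have hL : (0 : ℝ) ≤ L := by positivity
  set η : ℝ := 1 / (2 * L + 1) with hη
  have hη0 : 0 < η := by positivity
  have hη1 : η ≤ 1 := by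
    rw [hη, div_le_one (by positivity)]; linarith
  have hκL : κ * L = τ * L - σ * L := by rw [hκd]; ring
  have hκL' : κ * ((L : ℝ) - 1) = κ * L - κ := by ring
  have hrange : ∀ z ∈ S, -(L : ℤ) ≤ z.1 ∧ z.1 ≤ L := by
    intro z hz
    obtain ⟨⟨z1, z2⟩, z3, z4⟩ := (hS z).1 hz
    have e0 : κ * z.1 = τ * z.1 - σ * z.1 := by rw [hκd]; ring
    have e1 : κ * (-(L : ℝ)) ≤ κ * z.1 := by linarith
    have e2 : κ * (z.1 : ℝ) ≤ κ * L := by linarith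
    have e1' := le_of_mul_le_mul_left e1 hκ0
    have e2' := le_of_mul_le_mul_left e2 hκ0
    exact ⟨by exact_mod_cast e1', by exact_mod_cast e2'⟩
  have hup := abs_card_halfOpenPoints_sub_le (a := a - σ * L - η) (b := b - σ * L)
    (c := c - τ * L - η) (d := d - τ * L) hκ0 hκd hσ hτ (by linarith) (by linarith)
    (by linarith) (by push_cast; linarith)
  have hlo := abs_card_halfOpenPoints_sub_le (a := a - σ * L) (b := b - σ * L)
    (c := c - τ * L) (d := d - τ * L) hκ0 hκd hσ hτ (by linarith) (by linarith)
    (by linarith) (by push_cast; linarith)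
  have hcard_up : S.card ≤ (halfOpenPoints σ τ (a - σ * L - η) (b - σ * L) (c - τ * L - η)
      (d - τ * L) (2 * L + 1)).card := by
    refine Finset.card_le_card_of_injOn (fun z => ⟨(z.1 + L).toNat, z.2⟩) ?_ ?_
    · intro z hz
      obtain ⟨r1, r2⟩ := hrange z hz
      obtain ⟨⟨z1, z2⟩, z3, z4⟩ := (hS z).1 hz
      have e : (((z.1 + L).toNat : ℕ) : ℝ) = z.1 + L := by
        have : (((z.1 + L).toNat : ℕ) : ℤ) = z.1 + L := Int.toNat_of_nonneg (by omega)
        exact_mod_cast this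
      rw [Finset.mem_coe, mem_halfOpenPoints, e]
      refine ⟨by omega, ⟨?_, ?_⟩, ?_, ?_⟩ <;> linarith
    · intro z hz w hw hzw
      obtain ⟨r1, r2⟩ := hrange z hz
      obtain ⟨r3, r4⟩ := hrange w hw
      simp only [Sigma.mk.injEq, heq_eq_eq] at hzw
      exact Prod.ext (by omega) hzw.2
  have hcard_lo : (halfOpenPoints σ τ (a - σ * L) (b - σ * L) (c - τ * L)
      (d - τ * L) (2 * L + 1)).card ≤ S.card := by
    refine Finset.card_le_card_of_injOn (fun z => ((z.1 : ℤ) - L, z.2)) ?_ ?_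
    · rintro ⟨i, m⟩ hz
      obtain ⟨_, ⟨z1, z2⟩, z3, z4⟩ := mem_halfOpenPoints.1 (Finset.mem_coe.1 hz)
      rw [Finset.mem_coe, hS]
      push_cast
      refine ⟨⟨?_, ?_⟩, ?_, ?_⟩ <;> linarith
    · rintro ⟨i, m⟩ _ ⟨i', m'⟩ _ h
      simp only [Prod.mk.injEq] at h
      obtain ⟨h2, rfl⟩ := h
      have : i = i' := by omega
      rw [this]
  have c1 : (S.card : ℝ) ≤ _ := Nat.cast_le.2 hcard_up
  have c2 : _ ≤ (S.card : ℝ) := Nat.cast_le.2 hcard_lo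
  have harea1 : (b - σ * L - (a - σ * L)) * (d - τ * L - (c - τ * L)) / κ =
      (b - a) * (d - c) / κ := by ring
  have harea2 : (b - σ * L - (a - σ * L - η)) * (d - τ * L - (c - τ * L - η)) / κ ≤
      (b - a) * (d - c) / κ + 1 := by
    have hs : η * ((b - a) + (d - c) + η) ≤ κ := by
      have h3 : (b - a) + (d - c) + η ≤ κ * (2 * L + 1) := by nlinarith
      calc η * ((b - a) + (d - c) + η) ≤ η * (κ * (2 * L + 1)) := by gcongr
        _ = κ := by rw [hη]; field_simp
    have : (b - σ * L - (a - σ * L - η)) * (d - τ * L - (c - τ * L - η)) / κ =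
        (b - a) * (d - c) / κ + η * ((b - a) + (d - c) + η) / κ := by
      field_simp
      ring
    rw [this]
    have : η * ((b - a) + (d - c) + η) / κ ≤ 1 := (div_le_one hκ0).2 hs
    linarith
  rw [harea1] at hlo
  obtain ⟨u1, u2⟩ := abs_le.1 hup
  obtain ⟨v1, v2⟩ := abs_le.1 hlo
  rw [abs_le]
  constructor <;> linarith

/-! ### Choice of the rotation angle -/

/-- The direction `(c, s)` stays away from every nonzero integer vector of sup norm `k ≤ Q`. -/
def GoodPair (s c ε : ℝ) (Q : ℕ) : Prop :=
  ∀ (k : ℕ) (j : ℤ), 1 ≤ k → k ≤ Q → |j| ≤ k → ε / k ≤ |j * s - k * c| ∧ ε / k ≤ |k * s - j * c|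

lemma GoodPair.swap {s c ε : ℝ} {Q : ℕ} (h : GoodPair s c ε Q) : GoodPair c s ε Q := by
  intro k j h1 h2 h3
  obtain ⟨h4, h5⟩ := h k j h1 h2 h3
  exact ⟨by rwa [abs_sub_comm], by rwa [abs_sub_comm]⟩

lemma GoodPair.le_abs_right {s c ε : ℝ} {Q : ℕ} (h : GoodPair s c ε Q) (hQ : 1 ≤ Q) :
    ε ≤ |c| := by
  simpa using (h 1 0 le_rfl hQ (by simp)).1

lemma GoodPair.badlyApprox {s c ε : ℝ} {Q B : ℕ} (h : GoodPair s c ε Q) (hε : 0 < ε)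
    (hs : |s| ≤ 1) (hc : |c| ≤ 1) (hQ : 1 ≤ Q) (hB : 2 * (B : ℝ) ≤ ε * Q) :
    BadlyApprox (s / c) (ε / 2) B := by
  intro q p hq1 hqB
  have hεc : ε ≤ |c| := h.le_abs_right hQ
  have hc0 : 0 < |c| := by linarith
  have hcne : c ≠ 0 := abs_pos.1 hc0
  have hq0 : (0 : ℝ) < q := by exact_mod_cast hq1
  have hq1' : (1 : ℝ) ≤ q := by exact_mod_cast hq1
  have hqB' : (q : ℝ) ≤ B := by exact_mod_cast hqB
  have hQ0 : (0 : ℝ) < Q := by exact_mod_cast hQ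
  have hqQ : q ≤ Q := by
    have : (q : ℝ) ≤ Q := by nlinarith
    exact_mod_cast this
  have hX : |q * (s / c) - p| = |q * s - p * c| / |c| := by
    rw [← abs_div]
    congr 1
    field_simp
  rw [hX, le_div_iff₀ hc0]
  by_cases hbig : 1 ≤ |q * s - p * c|
  · have : ε / 2 / q ≤ 1 := by
      rw [div_le_one hq0]; linarith
    nlinarith [div_nonneg (div_nonneg hε.le zero_le_two) hq0.le]
  push Not at hbig
  by_cases hpq : |p| ≤ q
  · have h1 := (h q p hq1 hqQ hpq).2
    calc ε / 2 / q * |c| ≤ ε / 2 / q * 1 := by gcongr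
      _ ≤ ε / q := by rw [mul_one]; gcongr; linarith
      _ ≤ _ := h1
  · push Not at hpq
    have hpc : |(p : ℝ)| * |c| ≤ 2 * q := by
      have h1 : |(p : ℝ) * c| ≤ |q * s| + |q * s - p * c| := by
        have := abs_sub (q * s) (q * s - p * c)
        simpa using this
      rw [abs_mul, abs_mul, abs_of_pos hq0] at h1
      nlinarith
    have hk : ((p.natAbs : ℕ) : ℝ) = |(p : ℝ)| := by
      rw [Nat.cast_natAbs, Int.cast_abs]
    have hk1 : q < p.natAbs := by
      have : (q : ℤ) < (p.natAbs : ℤ) := by rw [Int.natCast_natAbs]; exact hpq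
      exact_mod_cast this
    have hkQ : p.natAbs ≤ Q := by
      have h1 : ε * |(p : ℝ)| ≤ ε * Q := by
        calc ε * |(p : ℝ)| ≤ |c| * |(p : ℝ)| := by gcongr
          _ ≤ 2 * q := by linarith
          _ ≤ 2 * B := by gcongr
          _ ≤ _ := hB
      have h2 := le_of_mul_le_mul_left h1 hε
      rw [← hk] at h2
      exact_mod_cast h2
    have hlow : ε / |(p : ℝ)| ≤ |q * s - p * c| := by
      rcases le_total 0 p with hp | hp
      · have h1 := (h p.natAbs q (by omega) hkQ (by simp; omega)).1
        rw [hk, abs_of_nonneg (by exact_mod_cast hp : (0 : ℝ) ≤ p)] at h1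
        rw [abs_of_nonneg (by exact_mod_cast hp : (0 : ℝ) ≤ p)]
        exact_mod_cast h1
      · have h1 := (h p.natAbs (-q) (by omega) hkQ (by simp; omega)).1
        rw [hk, abs_of_nonpos (by exact_mod_cast hp : (p : ℝ) ≤ 0)] at h1
        rw [abs_of_nonpos (by exact_mod_cast hp : (p : ℝ) ≤ 0)]
        push_cast at h1
        rw [show -(q : ℝ) * s - -(p : ℝ) * c = -(q * s - p * c) by ring, abs_neg] at h1
        exact h1
    have hp0 : 0 < |(p : ℝ)| := by
      rw [← hk]; exact_mod_cast (by omega : 0 < p.natAbs)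
    refine le_trans ?_ hlow
    rw [div_div, div_mul_eq_mul_div, div_le_div_iff₀ (by positivity) hp0]
    calc ε * |c| * |(p : ℝ)| = ε * (|(p : ℝ)| * |c|) := by ring
      _ ≤ ε * (2 * q) := by gcongr

lemma GoodPair.of_close {x y ε δ : ℝ} {Q : ℕ}
    (h : GoodPair (Real.sin x) (Real.cos x) (2 * ε) Q) (hxy : |y - x| ≤ δ)
    (hδ : 2 * (Q : ℝ) ^ 2 * δ ≤ ε) : GoodPair (Real.sin y) (Real.cos y) ε Q := by
  have hsin : |Real.sin x - Real.sin y| ≤ δ := by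
    rw [abs_sub_comm]; exact (Real.abs_sin_sub_sin_le _ _).trans hxy
  have hcos : |Real.cos x - Real.cos y| ≤ δ := by
    rw [abs_sub_comm]; exact (Real.abs_cos_sub_cos_le _ _).trans hxy
  have hδ0 : 0 ≤ δ := (abs_nonneg _).trans hxy
  have key : ∀ (k : ℕ) (u v : ℝ), 1 ≤ k → k ≤ Q → |u| ≤ k → |v| ≤ k →
      2 * ε / k ≤ |u * Real.sin x - v * Real.cos x| →
      ε / k ≤ |u * Real.sin y - v * Real.cos y| := by
    intro k u v hk hkQ hu hv hx
    have hk0 : (0 : ℝ) < k := by exact_mod_cast hk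
    have hkQ' : (k : ℝ) ≤ Q := by exact_mod_cast hkQ
    have h1 : |u * Real.sin x - v * Real.cos x| ≤ |u * Real.sin y - v * Real.cos y| +
        (|u| * |Real.sin x - Real.sin y| + |v| * |Real.cos x - Real.cos y|) := by
      rw [← abs_mul, ← abs_mul]
      have e : u * Real.sin x - v * Real.cos x = (u * Real.sin y - v * Real.cos y) +
          (u * (Real.sin x - Real.sin y) - v * (Real.cos x - Real.cos y)) := by ring
      rw [e]
      exact (abs_add_le _ _).trans (add_le_add_right (abs_sub _ _) _)
    have h2 : |u| * |Real.sin x - Real.sin y| + |v| * |Real.cos x - Real.cos y| ≤ ε / k := by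
      calc _ ≤ (k : ℝ) * δ + k * δ := by gcongr
        _ ≤ ε / k := by
          rw [le_div_iff₀ hk0]
          calc ((k : ℝ) * δ + k * δ) * k = 2 * (k : ℝ) ^ 2 * δ := by ring
            _ ≤ 2 * (Q : ℝ) ^ 2 * δ := by gcongr
            _ ≤ ε := hδ
    have h3 : 2 * ε / k = ε / k + ε / k := by ring
    linarith
  intro k j hk hkQ hj
  have hj' : |(j : ℝ)| ≤ k := by exact_mod_cast hj
  obtain ⟨h1, h2⟩ := h k j hk hkQ hj
  exact ⟨key k j k hk hkQ hj' (by simp) h1, key k k j hk hkQ (by simp) hj' h2⟩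

lemma volume_near_resonance_le {x u v ε : ℝ} {k : ℕ} (hk : 1 ≤ k)
    (huv : (k : ℝ) ^ 2 ≤ u ^ 2 + v ^ 2) :
    volume {α ∈ Set.Icc (0 : ℝ) 1 | |u * Real.sin (x - α) - v * Real.cos (x - α)| < ε / k} ≤
      ENNReal.ofReal (4 * ε / (k : ℝ) ^ 2) := by
  refine (Real.volume_le_diam _).trans (Metric.ediam_le fun α hα β hβ => ?_)
  rw [edist_dist]
  apply ENNReal.ofReal_le_ofReal
  obtain ⟨⟨a0, a1⟩, ha⟩ := hα
  obtain ⟨⟨b0, b1⟩, hb⟩ := hβ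
  have hk0 : (0 : ℝ) < k := by exact_mod_cast hk
  have hε : 0 < ε / k := (abs_nonneg _).trans_lt ha
  set r := Real.sqrt (u ^ 2 + v ^ 2) with hr
  have hr2 : r ^ 2 = u ^ 2 + v ^ 2 := Real.sq_sqrt (by positivity)
  have hkr : (k : ℝ) ≤ r := Real.le_sqrt_of_sq_le huv
  have hr0 : 0 < r := hk0.trans_le hkr
  have hY : ∀ z : ℝ, |u * Real.cos z + v * Real.sin z| ≤ r := by
    intro z
    refine Real.abs_le_sqrt ?_
    nlinarith [sq_nonneg (u * Real.sin z - v * Real.cos z), Real.sin_sq_add_cos_sq z]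
  have hid : r ^ 2 * Real.sin (β - α) =
      (u * Real.sin (x - α) - v * Real.cos (x - α)) *
        (u * Real.cos (x - β) + v * Real.sin (x - β)) -
      (u * Real.cos (x - α) + v * Real.sin (x - α)) *
        (u * Real.sin (x - β) - v * Real.cos (x - β)) := by
    rw [hr2, show β - α = (x - α) - (x - β) by ring, Real.sin_sub]
    ring
  have hsin : r * |Real.sin (β - α)| ≤ 2 * (ε / k) := by
    have h1 : r * (r * |Real.sin (β - α)|) ≤ r * (2 * (ε / k)) := by
      have h2 : r * (r * |Real.sin (β - α)|) = |r ^ 2 * Real.sin (β - α)| := by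
        rw [abs_mul, abs_of_nonneg (sq_nonneg r)]; ring
      rw [h2, hid]
      refine (abs_sub _ _).trans ?_
      rw [abs_mul, abs_mul]
      have h3 := mul_le_mul ha.le (hY (x - β)) (abs_nonneg _) hε.le
      have h4 := mul_le_mul (hY (x - α)) hb.le (abs_nonneg _) hr0.le
      linarith
    exact le_of_mul_le_mul_left h1 hr0
  have hpi : |β - α| ≤ Real.pi / 2 := by
    rw [abs_le]
    constructor <;> linarith [Real.pi_gt_three]
  have hjordan := Real.mul_abs_le_abs_sin hpi
  have hhalf : 1 / 2 * |β - α| ≤ |Real.sin (β - α)| := by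
    refine le_trans ?_ hjordan
    refine mul_le_mul_of_nonneg_right ?_ (abs_nonneg _)
    rw [div_le_div_iff₀ two_pos Real.pi_pos]
    linarith [Real.pi_le_four]
  rw [Real.dist_eq, abs_sub_comm, le_div_iff₀ (by positivity)]
  have h5 : (k : ℝ) * |Real.sin (β - α)| ≤ 2 * (ε / k) :=
    le_trans (by gcongr) hsin
  rw [mul_div_assoc', le_div_iff₀ hk0] at h5
  nlinarith [sq_nonneg (k : ℝ)]

lemma measure_biUnion_finset_le_ofReal {ι : Type*} (s : Finset ι) (A : ι → Set ℝ) (f : ι → ℝ)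
    (hf : ∀ i ∈ s, 0 ≤ f i) (hA : ∀ i ∈ s, volume (A i) ≤ ENNReal.ofReal (f i)) :
    volume (⋃ i ∈ s, A i) ≤ ENNReal.ofReal (∑ i ∈ s, f i) := by
  rw [ENNReal.ofReal_sum_of_nonneg hf]
  exact (measure_biUnion_finset_le s A).trans (Finset.sum_le_sum hA)

/-- Some rotation moves every angle of a small finite set away from all resonances. -/
lemma exists_rotation_goodPair (J : Finset ℝ) {ε : ℝ} (hε : 0 < ε) (Q : ℕ)
    (hsmall : J.card * (24 * ε * (1 + Real.log Q)) < 1) :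
    ∃ α : ℝ, ∀ x ∈ J, GoodPair (Real.sin (x - α)) (Real.cos (x - α)) ε Q := by
  set A : ℝ → ℝ → ℝ → ℕ → Set ℝ := fun x u v k =>
    {α ∈ Set.Icc (0 : ℝ) 1 | |u * Real.sin (x - α) - v * Real.cos (x - α)| < ε / k} with hAdef
  set U : Set ℝ := ⋃ x ∈ J, ⋃ k ∈ Finset.Icc 1 Q, ⋃ j ∈ Finset.Icc (-(k : ℤ)) k,
    (A x j k k ∪ A x k j k) with hU
  have hvol : volume U ≤ ENNReal.ofReal (∑ _x ∈ J, ∑ k ∈ Finset.Icc 1 Q,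
      ∑ _j ∈ Finset.Icc (-(k : ℤ)) k, 8 * ε / (k : ℝ) ^ 2) := by
    refine measure_biUnion_finset_le_ofReal _ _ _ (fun x _ => by positivity) fun x _ => ?_
    refine measure_biUnion_finset_le_ofReal _ _ _ (fun k _ => by positivity) fun k hk => ?_
    refine measure_biUnion_finset_le_ofReal _ _ _ (fun j _ => by positivity) fun j _ => ?_
    have hk1 : 1 ≤ k := (Finset.mem_Icc.1 hk).1
    refine (measure_union_le _ _).trans ?_
    have e : 8 * ε / (k : ℝ) ^ 2 = 4 * ε / (k : ℝ) ^ 2 + 4 * ε / (k : ℝ) ^ 2 := by ring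
    rw [e, ENNReal.ofReal_add (by positivity) (by positivity)]
    exact add_le_add
      (volume_near_resonance_le hk1 (by nlinarith [sq_nonneg (j : ℝ)]))
      (volume_near_resonance_le hk1 (by nlinarith [sq_nonneg (j : ℝ)]))
  have hharm : ∑ k ∈ Finset.Icc 1 Q, (1 / (k : ℝ)) ≤ 1 + Real.log Q := by
    have h1 := harmonic_le_one_add_log Q
    rw [harmonic_eq_sum_Icc] at h1
    push_cast at h1
    simpa using h1
  have hsum : ∑ _x ∈ J, ∑ k ∈ Finset.Icc 1 Q,
      ∑ _j ∈ Finset.Icc (-(k : ℤ)) k, 8 * ε / (k : ℝ) ^ 2 < 1 := by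
    have h1 : ∑ k ∈ Finset.Icc 1 Q, ∑ _j ∈ Finset.Icc (-(k : ℤ)) k, 8 * ε / (k : ℝ) ^ 2 ≤
        24 * ε * (1 + Real.log Q) := by
      calc _ ≤ ∑ k ∈ Finset.Icc 1 Q, 24 * ε * (1 / (k : ℝ)) := by
            refine Finset.sum_le_sum fun k hk => ?_
            have hk1 : 1 ≤ k := (Finset.mem_Icc.1 hk).1
            have hk1' : (1 : ℝ) ≤ k := by exact_mod_cast hk1
            have hk0 : (0 : ℝ) < k := by linarith
            have hcard : ((Finset.Icc (-(k : ℤ)) k).card : ℝ) = 2 * k + 1 := by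
              rw [Int.card_Icc]
              have : (((k : ℤ) + 1 - -(k : ℤ)).toNat : ℤ) = 2 * k + 1 := by omega
              exact_mod_cast this
            rw [Finset.sum_const, nsmul_eq_mul, hcard, mul_one_div, mul_div_assoc',
              div_le_div_iff₀ (by positivity) hk0]
            have : (2 * (k : ℝ) + 1) * (8 * ε) ≤ 24 * ε * k := by nlinarith
            nlinarith
        _ ≤ _ := by
            rw [← Finset.mul_sum]
            gcongr
    rw [Finset.sum_const, nsmul_eq_mul]
    refine lt_of_le_of_lt ?_ hsmall
    gcongr
  have hlt : volume U < volume (Set.Icc (0 : ℝ) 1) := by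
    refine hvol.trans_lt ?_
    rw [Real.volume_Icc]
    exact (ENNReal.ofReal_lt_ofReal_iff (by norm_num)).2 (by linarith)
  obtain ⟨α, hα, hαU⟩ : ∃ α ∈ Set.Icc (0 : ℝ) 1, α ∉ U := by
    by_contra hcon
    push Not at hcon
    exact absurd (measure_mono (μ := volume) hcon) (not_le.2 hlt)
  refine ⟨α, fun x hx k j hk hkQ hj => ?_⟩
  have hnot : α ∉ A x j k k ∪ A x k j k := by
    intro hmem
    apply hαU
    simp only [hU, Set.mem_iUnion]
    exact ⟨x, hx, k, Finset.mem_Icc.2 ⟨hk, hkQ⟩, j,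
      Finset.mem_Icc.2 (abs_le.1 hj), hmem⟩
  constructor
  · by_contra hlt'
    exact hnot (Or.inl ⟨hα, not_le.1 hlt'⟩)
  · by_contra hlt'
    exact hnot (Or.inr ⟨hα, not_le.1 hlt'⟩)

/-! ### Lattice points in rotated rectangles -/

/-- The discrepancy bound obtained from resonance constant `ε` in a strip of half-width `L`. -/
def discBound (ε : ℝ) (L : ℕ) : ℝ := 32 / ε * (Nat.log 2 (2 * L + 1) + 1) + 8 / ε + 1

lemma GoodPair.neg {s c ε : ℝ} {Q : ℕ} (h : GoodPair s c ε Q) : GoodPair (-s) (-c) ε Q := by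
  intro k j h1 h2 h3
  obtain ⟨h4, h5⟩ := h k j h1 h2 h3
  rw [← abs_neg] at h4 h5
  constructor
  · convert h4 using 2; ring
  · convert h5 using 2; ring

lemma GoodPair.rotate {s c ε : ℝ} {Q : ℕ} (h : GoodPair s c ε Q) : GoodPair (-c) s ε Q := by
  intro k j h1 h2 h3
  obtain ⟨h4, h5⟩ := h k (-j) h1 h2 (by rwa [abs_neg])
  rw [← abs_neg] at h5
  push_cast at h4 h5
  constructor
  · convert h5 using 2; ring
  · convert h4 using 2; ring

lemma abs_card_strips_sub_le_of_pos {s c ε A A' C C' : ℝ} {Q L : ℕ} (hgood : GoodPair s c ε Q)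
    (hε : 0 < ε) (hs : 0 < s) (hc : 0 < c) (hsc : s ^ 2 + c ^ 2 = 1) (hQ : 1 ≤ Q)
    (hL : 2 * ((2 * L + 1 : ℕ) : ℝ) ≤ ε * Q) (hA : A ≤ A') (hC : C ≤ C')
    (hcorner : ∀ X ∈ Set.Icc A A', ∀ Y ∈ Set.Icc C C', |X * c - Y * s| ≤ L - 1)
    (S : Finset (ℤ × ℤ))
    (hS : ∀ z : ℤ × ℤ, z ∈ S ↔ (A ≤ z.1 * c + z.2 * s ∧ z.1 * c + z.2 * s ≤ A') ∧
      (C ≤ -z.1 * s + z.2 * c ∧ -z.1 * s + z.2 * c ≤ C')) :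
    |(S.card : ℝ) - (A' - A) * (C' - C)| ≤ discBound ε L := by
  have hs1 : s ≤ 1 := by nlinarith
  have hc1 : c ≤ 1 := by nlinarith
  have hs1' : |s| ≤ 1 := by rwa [abs_of_pos hs]
  have hc1' : |c| ≤ 1 := by rwa [abs_of_pos hc]
  have hτ := (hgood.badlyApprox hε hs1' hc1' hQ hL).abs_floorErr_le (by positivity)
  have hσ := (hgood.swap.badlyApprox hε hc1' hs1' hQ hL).neg.abs_floorErr_le (by positivity)
  have hεc : ε ≤ c := by simpa [abs_of_pos hc] using hgood.le_abs_right hQ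
  have hεs : ε ≤ s := by simpa [abs_of_pos hs] using hgood.swap.le_abs_right hQ
  set E : ℝ := 2 / (ε / 2) * (Nat.log 2 (2 * L + 1) + 1) with hE
  have hmono : ∀ m ≤ 2 * L + 1, 2 / (ε / 2) * ((Nat.log 2 m : ℝ) + 1) ≤ E := by
    intro m hm
    rw [hE]
    gcongr
  have hκ : s / c - -(c / s) = 1 / (s * c) := by
    field_simp
    linarith
  have hκ2 : 2 ≤ 1 / (s * c) := by
    rw [le_div_iff₀ (by positivity)]
    nlinarith [sq_nonneg (s - c)]
  have hκε : 1 / (s * c) ≤ 2 / ε := by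
    rw [← hκ, sub_neg_eq_add]
    have h1 : s / c ≤ 1 / ε := by gcongr
    have h2 : c / s ≤ 1 / ε := by gcongr
    calc s / c + c / s ≤ 1 / ε + 1 / ε := add_le_add h1 h2
      _ = 2 / ε := by ring
  have hd : C' / c - A / s ≤ 1 / (s * c) * (L - 1) := by
    have h1 := (abs_le.1 (hcorner A ⟨le_rfl, hA⟩ C' ⟨hC, le_rfl⟩)).1
    have h2 : C' / c - A / s = 1 / (s * c) * (C' * s - A * c) := by field_simp
    rw [h2]
    exact mul_le_mul_of_nonneg_left (by linarith) (by positivity)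
  have hb : A' / s - C / c ≤ 1 / (s * c) * (L - 1) := by
    have h1 := (abs_le.1 (hcorner A' ⟨hA, le_rfl⟩ C ⟨le_rfl, hC⟩)).2
    have h2 : A' / s - C / c = 1 / (s * c) * (A' * c - C * s) := by field_simp
    rw [h2]
    exact mul_le_mul_of_nonneg_left h1 (by positivity)
  have key := abs_card_closed_sub_le hκ2 hκ.symm
    (fun m hm β => (hσ m hm β).trans (hmono m hm)) (fun m hm β => (hτ m hm β).trans (hmono m hm))
    (by gcongr : A / s ≤ A' / s) (by gcongr : C / c ≤ C' / c) hd hb S (by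
      intro z
      rw [hS]
      have e1 : A / s + -(c / s) * z.1 ≤ z.2 ↔ A ≤ z.1 * c + z.2 * s := by
        rw [show A / s + -(c / s) * z.1 = (A - z.1 * c) / s by field_simp; ring, div_le_iff₀ hs]
        constructor <;> intro h <;> linarith
      have e2 : (z.2 : ℝ) ≤ A' / s + -(c / s) * z.1 ↔ z.1 * c + z.2 * s ≤ A' := by
        rw [show A' / s + -(c / s) * z.1 = (A' - z.1 * c) / s by field_simp; ring, le_div_iff₀ hs]
        constructor <;> intro h <;> linarith
      have e3 : C / c + s / c * z.1 ≤ z.2 ↔ C ≤ -z.1 * s + z.2 * c := by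
        rw [show C / c + s / c * z.1 = (C + z.1 * s) / c by field_simp, div_le_iff₀ hc]
        constructor <;> intro h <;> linarith
      have e4 : (z.2 : ℝ) ≤ C' / c + s / c * z.1 ↔ -z.1 * s + z.2 * c ≤ C' := by
        rw [show C' / c + s / c * z.1 = (C' + z.1 * s) / c by field_simp, le_div_iff₀ hc]
        constructor <;> intro h <;> linarith
      rw [e1, e2, e3, e4])
  have harea : (A' / s - A / s) * (C' / c - C / c) / (1 / (s * c)) = (A' - A) * (C' - C) := by
    field_simp
  rw [harea] at key
  refine key.trans ?_
  have : 8 * E = 32 / ε * (Nat.log 2 (2 * L + 1) + 1) := by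
    rw [hE]; field_simp; ring
  have h8 : 4 * (1 / (s * c)) ≤ 8 / ε := by
    calc 4 * (1 / (s * c)) ≤ 4 * (2 / ε) := by gcongr
      _ = 8 / ε := by ring
  unfold discBound
  linarith

lemma abs_card_strips_sub_le_of_pos_sin {s c ε A A' C C' : ℝ} {Q L : ℕ}
    (hgood : GoodPair s c ε Q)
    (hε : 0 < ε) (hs : 0 < s) (hsc : s ^ 2 + c ^ 2 = 1) (hQ : 1 ≤ Q)
    (hL : 2 * ((2 * L + 1 : ℕ) : ℝ) ≤ ε * Q) (hA : A ≤ A') (hC : C ≤ C')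
    (hcorner : ∀ X ∈ Set.Icc A A', ∀ Y ∈ Set.Icc C C', |X * c - Y * s| ≤ L - 1)
    (S : Finset (ℤ × ℤ))
    (hS : ∀ z : ℤ × ℤ, z ∈ S ↔ (A ≤ z.1 * c + z.2 * s ∧ z.1 * c + z.2 * s ≤ A') ∧
      (C ≤ -z.1 * s + z.2 * c ∧ -z.1 * s + z.2 * c ≤ C')) :
    |(S.card : ℝ) - (A' - A) * (C' - C)| ≤ discBound ε L := by
  have hc0 : c ≠ 0 := abs_pos.1 (hε.trans_le (hgood.le_abs_right hQ))
  rcases lt_or_gt_of_ne hc0 with hc | hc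
  · have := abs_card_strips_sub_le_of_pos (A := -C') (A' := -C) (C := A) (C' := A') hgood.rotate hε
      (neg_pos.2 hc) hs (by linarith) hQ hL (by linarith) hA (by
        intro X hX Y hY
        have := hcorner Y hY (-X) ⟨by linarith [hX.2], by linarith [hX.1]⟩
        convert this using 2
        ring) S (by
        intro z
        rw [hS]
        constructor
        · rintro ⟨⟨h1, h2⟩, h3, h4⟩
          refine ⟨⟨?_, ?_⟩, ?_, ?_⟩ <;> linarith
        · rintro ⟨⟨h1, h2⟩, h3, h4⟩
          refine ⟨⟨?_, ?_⟩, ?_, ?_⟩ <;> linarith)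
    convert this using 2
    ring
  · exact abs_card_strips_sub_le_of_pos hgood hε hs hc hsc hQ hL hA hC hcorner S hS

/-- Lattice points in a rectangle with direction `(c, s)`, in terms of its two strips. -/
lemma abs_card_strips_sub_le {s c ε A A' C C' : ℝ} {Q L : ℕ} (hgood : GoodPair s c ε Q)
    (hε : 0 < ε) (hsc : s ^ 2 + c ^ 2 = 1) (hQ : 1 ≤ Q)
    (hL : 2 * ((2 * L + 1 : ℕ) : ℝ) ≤ ε * Q) (hA : A ≤ A') (hC : C ≤ C')
    (hcorner : ∀ X ∈ Set.Icc A A', ∀ Y ∈ Set.Icc C C', |X * c - Y * s| ≤ L - 1)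
    (S : Finset (ℤ × ℤ))
    (hS : ∀ z : ℤ × ℤ, z ∈ S ↔ (A ≤ z.1 * c + z.2 * s ∧ z.1 * c + z.2 * s ≤ A') ∧
      (C ≤ -z.1 * s + z.2 * c ∧ -z.1 * s + z.2 * c ≤ C')) :
    |(S.card : ℝ) - (A' - A) * (C' - C)| ≤ discBound ε L := by
  have hs0 : s ≠ 0 := abs_pos.1 (hε.trans_le (hgood.swap.le_abs_right hQ))
  rcases lt_or_gt_of_ne hs0 with hs | hs
  · have := abs_card_strips_sub_le_of_pos_sin (A := -A') (A' := -A) (C := -C') (C' := -C)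
      hgood.neg hε (neg_pos.2 hs) (by linarith) hQ hL (by linarith) (by linarith) (by
        intro X hX Y hY
        have := hcorner (-X) ⟨by linarith [hX.2], by linarith [hX.1]⟩ (-Y)
          ⟨by linarith [hY.2], by linarith [hY.1]⟩
        convert this using 2
        ring) S (by
        intro z
        rw [hS]
        constructor
        · rintro ⟨⟨h1, h2⟩, h3, h4⟩
          refine ⟨⟨?_, ?_⟩, ?_, ?_⟩ <;> linarith
        · rintro ⟨⟨h1, h2⟩, h3, h4⟩
          refine ⟨⟨?_, ?_⟩, ?_, ?_⟩ <;> linarith)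
    convert this using 2
    ring
  · exact abs_card_strips_sub_le_of_pos_sin hgood hε hs hsc hQ hL hA hC hcorner S hS

lemma mem_rect {φ w h : ℝ} {p x : ℝ × ℝ} :
    x ∈ rect φ p w h ↔
      (0 ≤ (x.1 - p.1) * Real.cos φ + (x.2 - p.2) * Real.sin φ ∧
        (x.1 - p.1) * Real.cos φ + (x.2 - p.2) * Real.sin φ ≤ w) ∧
      (0 ≤ -(x.1 - p.1) * Real.sin φ + (x.2 - p.2) * Real.cos φ ∧
        -(x.1 - p.1) * Real.sin φ + (x.2 - p.2) * Real.cos φ ≤ h) := by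
  have hsc := Real.sin_sq_add_cos_sq φ
  constructor
  · rintro ⟨y, ⟨⟨y1, y2⟩, y3, y4⟩, rfl⟩
    have e1 : ((p + rot φ y).1 - p.1) * Real.cos φ + ((p + rot φ y).2 - p.2) * Real.sin φ
        = y.1 := by
      simp only [rot, Prod.fst_add, Prod.snd_add]
      linear_combination y.1 * hsc
    have e2 : -((p + rot φ y).1 - p.1) * Real.sin φ + ((p + rot φ y).2 - p.2) * Real.cos φ
        = y.2 := by
      simp only [rot, Prod.fst_add, Prod.snd_add]
      linear_combination y.2 * hsc
    simp only [e1, e2]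
    exact ⟨⟨y1, y2⟩, y3, y4⟩
  · rintro ⟨h1, h2⟩
    refine ⟨((x.1 - p.1) * Real.cos φ + (x.2 - p.2) * Real.sin φ,
      -(x.1 - p.1) * Real.sin φ + (x.2 - p.2) * Real.cos φ), ⟨h1, h2⟩, ?_⟩
    apply Prod.ext
    · simp only [rot, Prod.fst_add]
      linear_combination (x.1 - p.1) * hsc
    · simp only [rot, Prod.snd_add]
      linear_combination (x.2 - p.2) * hsc

/-! ### The rotated lattice in the unit square -/

lemma volume_rect {φ w h : ℝ} (p : ℝ × ℝ) (hw : 0 ≤ w) (hh : 0 ≤ h) :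
    (volume (rect φ p w h)).toReal = w * h := by
  set f : ℝ × ℝ →ₗ[ℝ] ℝ × ℝ := Matrix.toLin (Module.Basis.finTwoProd ℝ) (Module.Basis.finTwoProd ℝ)
    !![Real.cos φ, -Real.sin φ; Real.sin φ, Real.cos φ] with hf
  have hrot : ∀ x, rot φ x = f x := by
    intro x
    rw [hf, Matrix.toLin_finTwoProd_apply]
    apply Prod.ext
    · simp only [rot]; ring
    · simp only [rot]; ring
  have hdet : LinearMap.det f = 1 := by
    rw [hf, LinearMap.det_toLin, Matrix.det_fin_two_of]
    linarith [Real.sin_sq_add_cos_sq φ]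
  have hrect : rect φ p w h = (fun y => p + y) '' (f '' (Set.Icc 0 w ×ˢ Set.Icc 0 h)) := by
    rw [Set.image_image]
    simp only [rect, hrot]
  rw [hrect, Set.image_add_left, measure_preimage_add, Measure.addHaar_image_linearMap, hdet,
    Measure.volume_eq_prod, Measure.prod_prod, Real.volume_Icc, Real.volume_Icc]
  simp [hw, hh]

lemma rect_zero_eq_unitSq : rect 0 0 1 1 = unitSq := by
  ext x
  rw [mem_rect]
  simp only [unitSq, Set.mem_prod, Set.mem_Icc]
  simp

/-- The points of the rotated lattice of mesh `1 / r`. -/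
def latticePt (α r : ℝ) (z : ℤ × ℤ) : ℝ × ℝ := rot α (z.1 / r, z.2 / r)

lemma latticePt_fst_coord {α r : ℝ} (hr : 0 < r) (z : ℤ × ℤ) (φ : ℝ) :
    r * ((latticePt α r z).1 * Real.cos φ + (latticePt α r z).2 * Real.sin φ) =
      z.1 * Real.cos (φ - α) + z.2 * Real.sin (φ - α) := by
  simp only [latticePt, rot, Real.cos_sub, Real.sin_sub]
  field_simp
  ring

lemma latticePt_snd_coord {α r : ℝ} (hr : 0 < r) (z : ℤ × ℤ) (φ : ℝ) :
    r * (-(latticePt α r z).1 * Real.sin φ + (latticePt α r z).2 * Real.cos φ) =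
      -z.1 * Real.sin (φ - α) + z.2 * Real.cos (φ - α) := by
  simp only [latticePt, rot, Real.cos_sub, Real.sin_sub]
  field_simp
  ring

lemma latticePt_injective {α r : ℝ} (hr : 0 < r) : Function.Injective (latticePt α r) := by
  intro z w hzw
  have h1 := latticePt_fst_coord (α := α) hr z α
  have h2 := latticePt_snd_coord (α := α) hr z α
  rw [hzw, latticePt_fst_coord hr w α] at h1
  rw [hzw, latticePt_snd_coord hr w α] at h2
  simp only [sub_self, Real.cos_zero, Real.sin_zero, mul_one, mul_zero, add_zero, zero_add] at h1 h2
  exact Prod.ext (by exact_mod_cast h1.symm) (by simpa using h2.symm)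

lemma abs_fst_mul_cos_add_snd_mul_sin_le {x : ℝ × ℝ} (hx : x ∈ unitSq) (α : ℝ) :
    |x.1 * Real.cos α + x.2 * Real.sin α| ≤ 2 := by
  obtain ⟨⟨h1, h2⟩, h3, h4⟩ := hx
  refine (abs_add_le _ _).trans ?_
  rw [abs_mul, abs_mul, abs_of_nonneg h1, abs_of_nonneg h3]
  nlinarith [Real.abs_cos_le_one α, Real.abs_sin_le_one α, abs_nonneg (Real.cos α),
    abs_nonneg (Real.sin α)]

lemma abs_le_of_latticePt_mem_unitSq {α r : ℝ} (hr : 0 < r) {z : ℤ × ℤ}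
    (hz : latticePt α r z ∈ unitSq) : |(z.1 : ℝ)| ≤ 2 * r ∧ |(z.2 : ℝ)| ≤ 2 * r := by
  have h1 := latticePt_fst_coord (α := α) hr z α
  have h2 := latticePt_fst_coord (α := α) hr z (α + Real.pi / 2)
  simp only [sub_self, add_sub_cancel_left, Real.cos_pi_div_two, Real.sin_pi_div_two,
    Real.cos_zero, Real.sin_zero, mul_one, mul_zero, add_zero, zero_add] at h1 h2
  rw [← h1, ← h2, abs_mul, abs_mul, abs_of_pos hr]
  constructor
  · nlinarith [abs_fst_mul_cos_add_snd_mul_sin_le hz α]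
  · nlinarith [abs_fst_mul_cos_add_snd_mul_sin_le hz (α + Real.pi / 2)]

/-- Discrepancy of the rotated lattice for a rectangle whose direction avoids resonances. -/
lemma abs_card_lattice_rect_sub_le {α r φ ε w h : ℝ} {p : ℝ × ℝ} {Q L : ℕ} (hr : 0 < r)
    (hgood : GoodPair (Real.sin (φ - α)) (Real.cos (φ - α)) ε Q) (hε : 0 < ε) (hQ : 1 ≤ Q)
    (hL : 2 * ((2 * L + 1 : ℕ) : ℝ) ≤ ε * Q) (hrL : 2 * r ≤ L - 1) (hw : 0 < w) (hh : 0 < h)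
    (hsub : rect φ p w h ⊆ unitSq) (S : Finset (ℤ × ℤ))
    (hS : ∀ z, z ∈ S ↔ latticePt α r z ∈ rect φ p w h) :
    |(S.card : ℝ) - r ^ 2 * (w * h)| ≤ discBound ε L := by
  set A := r * (p.1 * Real.cos φ + p.2 * Real.sin φ) with hA
  set C := r * (-p.1 * Real.sin φ + p.2 * Real.cos φ) with hC
  have hscφ := Real.sin_sq_add_cos_sq φ
  have key := abs_card_strips_sub_le (A := A) (A' := A + r * w) (C := C) (C' := C + r * h)
    hgood hε (Real.sin_sq_add_cos_sq _) hQ hL (by nlinarith) (by nlinarith) (by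
      intro X hX Y hY
      have hmem : ((X * Real.cos φ - Y * Real.sin φ) / r, (X * Real.sin φ + Y * Real.cos φ) / r) ∈
          rect φ p w h := by
        rw [mem_rect]
        have e1 : ((X * Real.cos φ - Y * Real.sin φ) / r - p.1) * Real.cos φ +
            ((X * Real.sin φ + Y * Real.cos φ) / r - p.2) * Real.sin φ = (X - A) / r := by
          rw [hA]
          field_simp
          linear_combination X * hscφ
        have e2 : -((X * Real.cos φ - Y * Real.sin φ) / r - p.1) * Real.sin φ +
            ((X * Real.sin φ + Y * Real.cos φ) / r - p.2) * Real.cos φ = (Y - C) / r := by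
          rw [hC]
          field_simp
          linear_combination Y * hscφ
        simp only [e1, e2]
        refine ⟨⟨div_nonneg (by linarith [hX.1]) hr.le, ?_⟩,
          div_nonneg (by linarith [hY.1]) hr.le, ?_⟩
        · rw [div_le_iff₀ hr]; linarith [hX.2]
        · rw [div_le_iff₀ hr]; linarith [hY.2]
      have hb := abs_fst_mul_cos_add_snd_mul_sin_le (hsub hmem) α
      have e : X * Real.cos (φ - α) - Y * Real.sin (φ - α) =
          r * ((X * Real.cos φ - Y * Real.sin φ) / r * Real.cos α +
            (X * Real.sin φ + Y * Real.cos φ) / r * Real.sin α) := by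
        rw [Real.cos_sub, Real.sin_sub]
        field_simp
        ring
      rw [e, abs_mul, abs_of_pos hr]
      refine le_trans ?_ hrL
      rw [mul_comm 2 r]
      gcongr) S (by
      intro z
      rw [hS, mem_rect, ← latticePt_fst_coord hr z φ, ← latticePt_snd_coord hr z φ, hA, hC]
      set x := latticePt α r z
      have e1 : (x.1 - p.1) * Real.cos φ + (x.2 - p.2) * Real.sin φ =
        (x.1 * Real.cos φ + x.2 * Real.sin φ) - (p.1 * Real.cos φ + p.2 * Real.sin φ) := by ring
      have e2 : -(x.1 - p.1) * Real.sin φ + (x.2 - p.2) * Real.cos φ =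
        (-x.1 * Real.sin φ + x.2 * Real.cos φ) - (-p.1 * Real.sin φ + p.2 * Real.cos φ) := by ring
      rw [e1, e2, ← mul_add, ← mul_add, mul_le_mul_iff_right₀ hr, mul_le_mul_iff_right₀ hr,
        mul_le_mul_iff_right₀ hr, mul_le_mul_iff_right₀ hr, sub_nonneg, sub_nonneg,
        sub_le_iff_le_add', sub_le_iff_le_add'])
  convert key using 2
  ring

open Classical in
/-- The points of the rotated lattice in the unit square, with coordinates at most `L`. -/
def gridPts (α r : ℝ) (L : ℕ) : Finset (ℝ × ℝ) :=
  ((Finset.Icc (-(L : ℤ)) L ×ˢ Finset.Icc (-(L : ℤ)) L).filter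
    fun z => latticePt α r z ∈ unitSq).image (latticePt α r)

lemma gridPts_subset_unitSq (α r : ℝ) (L : ℕ) : (gridPts α r L : Set (ℝ × ℝ)) ⊆ unitSq := by
  classical
  intro x hx
  simp only [gridPts, Finset.coe_image, Set.mem_image, Finset.mem_coe, Finset.mem_filter] at hx
  obtain ⟨z, ⟨_, hz⟩, rfl⟩ := hx
  exact hz

lemma abs_ncard_gridPts_inter_rect_sub_le {α r φ ε w h : ℝ} {p : ℝ × ℝ} {Q L : ℕ} (hr : 0 < r)
    (hgood : GoodPair (Real.sin (φ - α)) (Real.cos (φ - α)) ε Q) (hε : 0 < ε) (hQ : 1 ≤ Q)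
    (hL : 2 * ((2 * L + 1 : ℕ) : ℝ) ≤ ε * Q) (hrL : 2 * r ≤ L - 1) (hw : 0 < w) (hh : 0 < h)
    (hsub : rect φ p w h ⊆ unitSq) :
    |(((gridPts α r L : Set (ℝ × ℝ)) ∩ rect φ p w h).ncard : ℝ) - r ^ 2 * (w * h)| ≤
      discBound ε L := by
  classical
  set S := (Finset.Icc (-(L : ℤ)) L ×ˢ Finset.Icc (-(L : ℤ)) L).filter
    fun z => latticePt α r z ∈ rect φ p w h with hSdef
  have hbox : ∀ z : ℤ × ℤ, latticePt α r z ∈ unitSq →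
      z ∈ Finset.Icc (-(L : ℤ)) L ×ˢ Finset.Icc (-(L : ℤ)) L := by
    intro z hz
    obtain ⟨h1, h2⟩ := abs_le_of_latticePt_mem_unitSq hr hz
    have h1' : |(z.1 : ℝ)| ≤ L := by linarith
    have h2' : |(z.2 : ℝ)| ≤ L := by linarith
    rw [Finset.mem_product, Finset.mem_Icc, Finset.mem_Icc]
    exact ⟨abs_le.1 (by exact_mod_cast h1'), abs_le.1 (by exact_mod_cast h2')⟩
  have hset : (gridPts α r L : Set (ℝ × ℝ)) ∩ rect φ p w h =
      ((S.image (latticePt α r) : Finset (ℝ × ℝ)) : Set (ℝ × ℝ)) := by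
    ext x
    simp only [gridPts, hSdef, Set.mem_inter_iff, Finset.coe_image, Set.mem_image, Finset.mem_coe,
      Finset.mem_filter]
    constructor
    · rintro ⟨⟨z, ⟨hz, _⟩, rfl⟩, hx⟩
      exact ⟨z, ⟨hz, hx⟩, rfl⟩
    · rintro ⟨z, ⟨hz, hx⟩, rfl⟩
      exact ⟨⟨z, ⟨hz, hsub hx⟩, rfl⟩, hx⟩
  rw [hset, Set.ncard_coe_finset, Finset.card_image_of_injective _ (latticePt_injective hr)]
  refine abs_card_lattice_rect_sub_le hr hgood hε hQ hL hrL hw hh hsub S fun z => ?_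
  rw [hSdef, Finset.mem_filter]
  exact ⟨fun hz => hz.2, fun hz => ⟨hbox z (hsub hz), hz⟩⟩

/-! ### Adjusting the number of points -/

lemma abs_ncard_inter_sub_le_of_subset {X : Type*} {P P' : Finset X} (h : P ⊆ P') (R : Set X) :
    |(((P' : Set X) ∩ R).ncard : ℝ) - ((P : Set X) ∩ R).ncard| ≤ (P'.card : ℝ) - P.card := by
  classical
  have hfin : ∀ T : Finset X, (((T : Set X) ∩ R).ncard) = (T.filter (· ∈ R)).card := by
    intro T
    rw [← Set.ncard_coe_finset, Finset.coe_filter]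
    rfl
  rw [hfin, hfin]
  have h1 : (P.filter (· ∈ R)).card ≤ (P'.filter (· ∈ R)).card :=
    Finset.card_le_card (Finset.filter_subset_filter _ h)
  have h2 : (P.filter (· ∉ R)).card ≤ (P'.filter (· ∉ R)).card :=
    Finset.card_le_card (Finset.filter_subset_filter _ h)
  have h3 := Finset.card_filter_add_card_filter_not (s := P) (· ∈ R)
  have h4 := Finset.card_filter_add_card_filter_not (s := P') (· ∈ R)
  have h1' : ((P.filter (· ∈ R)).card : ℝ) ≤ (P'.filter (· ∈ R)).card := by exact_mod_cast h1
  have h2' : ((P.filter (· ∉ R)).card : ℝ) ≤ (P'.filter (· ∉ R)).card := by exact_mod_cast h2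
  have h3' : ((P.filter (· ∈ R)).card : ℝ) + (P.filter (· ∉ R)).card = P.card := by
    exact_mod_cast h3
  have h4' : ((P'.filter (· ∈ R)).card : ℝ) + (P'.filter (· ∉ R)).card = P'.card := by
    exact_mod_cast h4
  rw [abs_of_nonneg (by linarith)]
  linarith

lemma exists_card_eq_abs_ncard_inter_sub_le {X : Type*} {T : Set X} (hT : T.Infinite)
    (P : Finset X) (hP : (P : Set X) ⊆ T) (N : ℕ) :
    ∃ P' : Finset X, P'.card = N ∧ (P' : Set X) ⊆ T ∧ ∀ R : Set X,
      |(((P' : Set X) ∩ R).ncard : ℝ) - ((P : Set X) ∩ R).ncard| ≤ |(P.card : ℝ) - N| := by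
  rcases le_total N P.card with hN | hN
  · obtain ⟨P', hsub, hcard⟩ := Finset.exists_subset_card_eq hN
    refine ⟨P', hcard, (Finset.coe_subset.2 hsub).trans hP, fun R => ?_⟩
    rw [abs_sub_comm, ← hcard]
    exact (abs_ncard_inter_sub_le_of_subset hsub R).trans (le_abs_self _)
  · obtain ⟨T', h1, h2, h3⟩ := hT.exists_superset_ncard_eq hP P.finite_toSet
      (by rwa [Set.ncard_coe_finset] : (P : Set X).ncard ≤ N)
    rcases Nat.eq_zero_or_pos N with rfl | hpos
    · exact ⟨P, by omega, hP, fun R => by simp⟩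
    have hfin : T'.Finite := Set.finite_of_ncard_pos (by omega)
    refine ⟨hfin.toFinset, by rw [← Set.ncard_eq_toFinset_card T' hfin, h3], by simpa using h2,
      fun R => ?_⟩
    have hsub : P ⊆ hfin.toFinset := by
      rw [← Finset.coe_subset]; simpa using h1
    refine (abs_ncard_inter_sub_le_of_subset hsub R).trans ?_
    rw [← Set.ncard_eq_toFinset_card T' hfin, h3, abs_sub_comm]
    exact le_abs_self _

lemma infinite_unitSq : unitSq.Infinite :=
  (Set.Icc_infinite zero_lt_one).prod_left ⟨0, by simp⟩

/-! ### Choosing the rotation -/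

lemma one_le_plog (N : ℕ) : 1 ≤ plog N := le_max_left _ _

lemma plog_eq_logb {N : ℕ} (hN : 2 ≤ N) : plog N = Real.logb 2 N := by
  have hN' : (2 : ℝ) ≤ N := by exact_mod_cast hN
  refine max_eq_right ?_
  rw [Real.le_logb_iff_rpow_le (by norm_num) (by linarith), Real.rpow_one]
  exact hN'

lemma log_le_plog {N : ℕ} (hN : 2 ≤ N) : Real.log N ≤ plog N := by
  have h2 : (0 : ℝ) < Real.log 2 := Real.log_pos (by norm_num)
  have h0 : (0 : ℝ) ≤ Real.log N := Real.log_natCast_nonneg N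
  rw [plog_eq_logb hN, Real.logb, le_div_iff₀ h2]
  nlinarith [Real.log_two_lt_d9]

lemma natLog_le_plog {N : ℕ} (hN : 2 ≤ N) : (Nat.log 2 N : ℝ) ≤ plog N := by
  rw [plog_eq_logb hN]
  exact_mod_cast Real.natLog_le_logb N 2

/-- A set with the order-`M` covering property admits a lattice rotation for which all its
directions, and the horizontal one, avoid resonances. -/
lemma LacunaryCovering.exists_rotation {Ω : Set ℝ} {M : ℕ} (hcov : LacunaryCovering Ω M) :
    ∃ c : ℝ, 0 < c ∧ ∀ N : ℕ, 2 ≤ N → plog N ^ (M + 1) ≤ c * N →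
      ∃ α : ℝ, ∀ φ ∈ insert 0 Ω,
        GoodPair (Real.sin (φ - α)) (Real.cos (φ - α)) (c / plog N ^ (M + 1)) (N ^ 4) := by
  classical
  obtain ⟨K, hK⟩ := hcov
  set B : ℝ := (max K 0 + 1) * 10 ^ M with hB
  have hK0 : 0 ≤ max K 0 := le_max_right _ _
  have hB1 : 1 ≤ B := by
    have : (1 : ℝ) ≤ 10 ^ M := one_le_pow₀ (by norm_num)
    nlinarith
  refine ⟨1 / (241 * B), by positivity, fun N hN hbig => ?_⟩
  have hN' : (2 : ℝ) ≤ N := by exact_mod_cast hN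
  set l := plog N with hl
  have hl1 : 1 ≤ l := one_le_plog N
  have hlM : 1 ≤ l ^ (M + 1) := one_le_pow₀ hl1
  set ε := 1 / (241 * B) / l ^ (M + 1) with hε
  have hε0 : 0 < ε := by positivity
  have hε1 : ε ≤ 1 := by
    rw [hε, div_le_one (by positivity)]
    refine le_trans ?_ hlM
    rw [div_le_one (by positivity)]
    linarith
  have hεN : 1 ≤ ε * N := by
    rw [hε, div_mul_eq_mul_div, le_div_iff₀ (by positivity)]
    linarith
  have hN8 : (256 : ℝ) ≤ (N : ℝ) ^ 8 := by
    calc (256 : ℝ) = 2 ^ 8 := by norm_num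
      _ ≤ (N : ℝ) ^ 8 := by gcongr
  set δ := ε / (2 * (N : ℝ) ^ 8) with hδ
  have hδ0 : 0 < δ := by positivity
  have hδ1 : δ < 1 / 2 := by
    rw [hδ, div_lt_iff₀ (by positivity)]
    linarith
  obtain ⟨s, hs, hcover⟩ := hK δ hδ0 hδ1
  have hlog0 : 0 ≤ Real.logb 2 (1 / δ) := by
    refine Real.logb_nonneg (by norm_num) ?_
    rw [le_div_iff₀ hδ0]
    linarith
  have hlog1 : Real.logb 2 (1 / δ) ≤ 10 * l := by
    have h1 : 1 / δ ≤ 2 * (N : ℝ) ^ 9 := by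
      rw [hδ, one_div_div, div_le_iff₀ hε0]
      have : (2 : ℝ) * (N : ℝ) ^ 9 * ε = 2 * (N : ℝ) ^ 8 * (ε * N) := by ring
      rw [this]
      exact le_mul_of_one_le_right (by positivity) hεN
    have h2 := Real.logb_le_logb_of_le (b := 2) (by norm_num) (by positivity) h1
    rw [Real.logb_mul (by norm_num) (by positivity), Real.logb_self_eq_one (by norm_num),
      Real.logb_pow, ← plog_eq_logb hN, ← hl] at h2
    push_cast at h2
    linarith
  have hcard : ((insert 0 s).card : ℝ) ≤ B * l ^ M := by
    have h1 : ((insert 0 s).card : ℝ) ≤ s.card + 1 := by exact_mod_cast Finset.card_insert_le 0 s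
    have h2 : Real.logb 2 (1 / δ) ^ M ≤ (10 * l) ^ M := by gcongr
    have h3 : (1 : ℝ) ≤ (10 * l) ^ M := one_le_pow₀ (by linarith)
    have h4 : K * Real.logb 2 (1 / δ) ^ M ≤ max K 0 * (10 * l) ^ M :=
      mul_le_mul (le_max_left _ _) h2 (by positivity) hK0
    calc ((insert 0 s).card : ℝ) ≤ (max K 0 + 1) * (10 * l) ^ M := by linarith
      _ = B * l ^ M := by rw [hB, mul_pow]; ring
  have hlogQ : 1 + Real.log ((N ^ 4 : ℕ) : ℝ) ≤ 5 * l := by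
    push_cast
    rw [Real.log_pow]
    push_cast
    linarith [log_le_plog hN]
  have hlogQ0 : 0 ≤ Real.log ((N ^ 4 : ℕ) : ℝ) := Real.log_natCast_nonneg _
  obtain ⟨α, hα⟩ := exists_rotation_goodPair (insert 0 s) (ε := 2 * ε) (by positivity) (N ^ 4) (by
    calc ((insert 0 s).card : ℝ) * (24 * (2 * ε) * (1 + Real.log ((N ^ 4 : ℕ) : ℝ)))
        ≤ (B * l ^ M) * (24 * (2 * ε) * (5 * l)) := by gcongr
      _ = 240 / 241 := by rw [hε, pow_succ]; field_simp; norm_num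
      _ < 1 := by norm_num)
  have hclose : 2 * ((N ^ 4 : ℕ) : ℝ) ^ 2 * δ ≤ ε := by
    rw [hδ]
    push_cast
    apply le_of_eq
    field_simp
  refine ⟨α, fun φ hφ => ?_⟩
  rcases Set.mem_insert_iff.1 hφ with rfl | hφ
  · exact (hα 0 (Finset.mem_insert_self _ _)).of_close (by simpa using hδ0.le) hclose
  · have hmem := hcover hφ
    simp only [Set.mem_iUnion] at hmem
    obtain ⟨x, hx, hx1, hx2⟩ := hmem
    refine (hα x (Finset.mem_insert_of_mem hx)).of_close ?_ hclose
    rw [sub_sub_sub_cancel_right, abs_of_nonneg (by linarith)]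
    linarith

/-! ### The main bound -/

lemma exists_forall_plog_pow_le (k : ℕ) {c : ℝ} (hc : 0 < c) :
    ∃ N₀ : ℕ, ∀ N : ℕ, N₀ ≤ N → plog N ^ k ≤ c * N := by
  have h2 : (0 : ℝ) < Real.log 2 := Real.log_pos (by norm_num)
  have hlog : (fun x : ℝ => Real.log x ^ k) =o[Filter.atTop] (id : ℝ → ℝ) :=
    Real.isLittleO_pow_log_id_atTop
  have hev := (hlog.comp_tendsto tendsto_natCast_atTop_atTop).def
    (c := c * Real.log 2 ^ k) (by positivity)
  obtain ⟨N₀, hN₀⟩ := Filter.eventually_atTop.1 (hev.and (Filter.eventually_ge_atTop 2))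
  refine ⟨N₀, fun N hN => ?_⟩
  obtain ⟨h, hN2⟩ := hN₀ N hN
  have hpos : 0 ≤ Real.log N := Real.log_natCast_nonneg N
  simp only [Function.comp_apply, id_eq, Real.norm_eq_abs, abs_pow, abs_of_nonneg hpos,
    Nat.abs_cast] at h
  rw [plog_eq_logb hN2, Real.logb, div_pow, div_le_iff₀ (by positivity)]
  linarith

lemma discBound_le {c : ℝ} (hc : 0 < c) {N k : ℕ} (hN : 2 ≤ N) :
    discBound (c / plog N ^ k) (3 * N) ≤ (168 / c + 1) * plog N ^ (k + 1) := by
  set l := plog N with hl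
  have hl1 : 1 ≤ l := one_le_plog N
  have hlk : 1 ≤ l ^ k := one_le_pow₀ hl1
  have hlk1 : 1 ≤ l ^ (k + 1) := one_le_pow₀ hl1
  have hlog : (Nat.log 2 (2 * (3 * N) + 1) : ℝ) ≤ 3 + l := by
    have h1 : Nat.log 2 (2 * (3 * N) + 1) ≤ Nat.log 2 (N * 2 * 2 * 2) :=
      Nat.log_mono_right (by omega)
    rw [Nat.log_mul_base (by norm_num) (by omega), Nat.log_mul_base (by norm_num) (by omega),
      Nat.log_mul_base (by norm_num) (by omega)] at h1
    have h2 : (Nat.log 2 (2 * (3 * N) + 1) : ℝ) ≤ Nat.log 2 N + 1 + 1 + 1 := by exact_mod_cast h1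
    linarith [natLog_le_plog hN]
  have hlog' : (Nat.log 2 (2 * (3 * N) + 1) : ℝ) + 1 ≤ 5 * l := by linarith
  unfold discBound
  calc 32 / (c / l ^ k) * ((Nat.log 2 (2 * (3 * N) + 1) : ℝ) + 1) + 8 / (c / l ^ k) + 1
      ≤ 32 / (c / l ^ k) * (5 * l) + 8 / (c / l ^ k) * l + l ^ (k + 1) := by
        gcongr
        exact le_mul_of_one_le_right (by positivity) hl1
    _ = (168 / c + 1) * l ^ (k + 1) := by
        rw [pow_succ]; field_simp; ring

lemma volume_unitSq : (volume unitSq).toReal = 1 := by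
  rw [← rect_zero_eq_unitSq, volume_rect 0 zero_le_one zero_le_one, mul_one]

lemma volume_rect_le_one {φ w h : ℝ} {p : ℝ × ℝ} (hsub : rect φ p w h ⊆ unitSq) :
    (volume (rect φ p w h)).toReal ≤ 1 := by
  have hfin : volume unitSq ≠ ⊤ := by
    intro h
    simpa [h] using volume_unitSq
  rw [← volume_unitSq]
  exact ENNReal.toReal_mono hfin (measure_mono hsub)

lemma abs_ncard_inter_rect_sub_le_card {P : Finset (ℝ × ℝ)} {φ w h : ℝ} {p : ℝ × ℝ}
    (hsub : rect φ p w h ⊆ unitSq) :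
    |(((P : Set (ℝ × ℝ)) ∩ rect φ p w h).ncard : ℝ) -
      (P.card : ℝ) * (volume (rect φ p w h)).toReal| ≤ P.card := by
  have h1 : (((P : Set (ℝ × ℝ)) ∩ rect φ p w h).ncard : ℝ) ≤ P.card := by
    rw [← Set.ncard_coe_finset P]
    exact_mod_cast Set.ncard_le_ncard Set.inter_subset_left P.finite_toSet
  have h2 := volume_rect_le_one hsub
  have h3 : 0 ≤ (volume (rect φ p w h)).toReal := ENNReal.toReal_nonneg
  have h4 : (0 : ℝ) ≤ P.card := Nat.cast_nonneg _
  have h5 : (0 : ℝ) ≤ (((P : Set (ℝ × ℝ)) ∩ rect φ p w h).ncard : ℝ) := Nat.cast_nonneg _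
  rw [abs_le]
  constructor <;> nlinarith

/-- Adding or removing a few points of a good rotated lattice gives `N` points of small
directional discrepancy. -/
lemma exists_points_of_goodPair {Ω : Set ℝ} {α ε : ℝ} {N : ℕ} (hN : 4 ≤ N) (hε : 1 ≤ ε * N)
    (hgood : ∀ φ ∈ insert 0 Ω, GoodPair (Real.sin (φ - α)) (Real.cos (φ - α)) ε (N ^ 4)) :
    ∃ P : Finset (ℝ × ℝ), P.card = N ∧ (P : Set (ℝ × ℝ)) ⊆ unitSq ∧
      ∀ (φ : ℝ) (p : ℝ × ℝ) (w h : ℝ), φ ∈ Ω → 0 < w → 0 < h → rect φ p w h ⊆ unitSq →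
        |(((P : Set (ℝ × ℝ)) ∩ rect φ p w h).ncard : ℝ) -
          (N : ℝ) * (volume (rect φ p w h)).toReal| ≤ 2 * discBound ε (3 * N) := by
  have hN' : (4 : ℝ) ≤ N := by exact_mod_cast hN
  have hε0 : 0 < ε := pos_of_mul_pos_left (by linarith) (by linarith : (0 : ℝ) ≤ N)
  have hr : 0 < √(N : ℝ) := Real.sqrt_pos.2 (by linarith)
  have hr2 : √(N : ℝ) ^ 2 = N := Real.sq_sqrt (by linarith)
  have hQ : 1 ≤ N ^ 4 := Nat.one_le_pow _ _ (by omega)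
  have hL : 2 * ((2 * (3 * N) + 1 : ℕ) : ℝ) ≤ ε * ((N ^ 4 : ℕ) : ℝ) := by
    push_cast
    have h1 : (N : ℝ) ^ 3 ≤ ε * (N : ℝ) ^ 4 := by
      have : ε * (N : ℝ) ^ 4 = (ε * N) * (N : ℝ) ^ 3 := by ring
      rw [this]
      exact le_mul_of_one_le_left (by positivity) hε
    have h2 : (16 : ℝ) * N ≤ (N : ℝ) ^ 3 := by
      have h3 : (0 : ℝ) ≤ (N : ℝ) ^ 2 - 16 := by nlinarith
      nlinarith [mul_nonneg (by linarith : (0 : ℝ) ≤ N) h3]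
    linarith
  have hrL : 2 * √(N : ℝ) ≤ ((3 * N : ℕ) : ℝ) - 1 := by
    push_cast
    nlinarith [sq_nonneg (√(N : ℝ) - 1)]
  set P₀ := gridPts α (√(N : ℝ)) (3 * N) with hP₀
  have key : ∀ (φ : ℝ) (p : ℝ × ℝ) (w h : ℝ), φ ∈ insert 0 Ω → 0 < w → 0 < h →
      rect φ p w h ⊆ unitSq →
      |(((P₀ : Set (ℝ × ℝ)) ∩ rect φ p w h).ncard : ℝ) - N * (w * h)| ≤ discBound ε (3 * N) := by
    intro φ p w h hφ hw hh hsub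
    have := abs_ncard_gridPts_inter_rect_sub_le hr (hgood φ hφ) hε0 hQ hL hrL hw hh hsub
    rwa [hr2] at this
  have hP₀sub : (P₀ : Set (ℝ × ℝ)) ⊆ unitSq := gridPts_subset_unitSq _ _ _
  have hcard : |(P₀.card : ℝ) - N| ≤ discBound ε (3 * N) := by
    have := key 0 0 1 1 (Set.mem_insert _ _) one_pos one_pos rect_zero_eq_unitSq.subset
    rwa [rect_zero_eq_unitSq, Set.inter_eq_left.2 hP₀sub, Set.ncard_coe_finset, mul_one,
      mul_one] at this
  obtain ⟨P, hPcard, hPsub, hP⟩ :=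
    exists_card_eq_abs_ncard_inter_sub_le infinite_unitSq P₀ hP₀sub N
  refine ⟨P, hPcard, hPsub, fun φ p w h hφ hw hh hsub => ?_⟩
  rw [volume_rect p hw.le hh.le]
  have h1 := hP (rect φ p w h)
  have h2 := key φ p w h (Set.mem_insert_of_mem _ hφ) hw hh hsub
  have h3 := abs_sub_le (((P : Set (ℝ × ℝ)) ∩ rect φ p w h).ncard : ℝ)
    (((P₀ : Set (ℝ × ℝ)) ∩ rect φ p w h).ncard : ℝ) (N * (w * h))
  linarith

/-- If `Ω ⊆ [0, π/2]` is lacunary of order `M`, then `D_Ω(N) ≲ (log N)^{2M+1}`. -/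
theorem directional_discrepancy_lacunary_order_M
    (M : ℕ) (hM : 1 ≤ M) (Ω : Set ℝ) (hΩ : Ω ⊆ Set.Icc 0 (Real.pi / 2))
    (hcov : LacunaryCovering Ω M) :
    ∃ C : ℝ, 0 < C ∧ ∀ N : ℕ, 2 ≤ N →
      ∃ P : Finset (ℝ × ℝ), P.card = N ∧ (P : Set (ℝ × ℝ)) ⊆ unitSq ∧
        ∀ (φ : ℝ) (p : ℝ × ℝ) (w h : ℝ), φ ∈ Ω → 0 < w → 0 < h →
          rect φ p w h ⊆ unitSq →
          |(((P : Set (ℝ × ℝ)) ∩ rect φ p w h).ncard : ℝ) -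
              (N : ℝ) * (volume (rect φ p w h)).toReal| ≤ C * (plog N) ^ (2 * M + 1) := by
  obtain ⟨c, hc, hrot⟩ := hcov.exists_rotation
  obtain ⟨N₀, hN₀⟩ := exists_forall_plog_pow_le (M + 1) hc
  refine ⟨2 * (168 / c + 1) + (N₀ + 4), by positivity, fun N hN => ?_⟩
  have hl1 := one_le_plog N
  have hpow : 1 ≤ plog N ^ (2 * M + 1) := one_le_pow₀ hl1
  by_cases hlarge : N₀ + 4 ≤ N
  · have hbig := hN₀ N (by omega)
    obtain ⟨α, hα⟩ := hrot N hN hbig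
    have hε : 1 ≤ c / plog N ^ (M + 1) * N := by
      rw [div_mul_eq_mul_div, le_div_iff₀ (by positivity)]
      linarith
    obtain ⟨P, hcard, hsub, hP⟩ := exists_points_of_goodPair (by omega) hε hα
    refine ⟨P, hcard, hsub, fun φ p w h hφ hw hh hR => (hP φ p w h hφ hw hh hR).trans ?_⟩
    calc 2 * discBound (c / plog N ^ (M + 1)) (3 * N)
        ≤ 2 * ((168 / c + 1) * plog N ^ (M + 1 + 1)) := by gcongr; exact discBound_le hc hN
      _ ≤ 2 * ((168 / c + 1) * plog N ^ (2 * M + 1)) := by gcongr; omega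
      _ = 2 * (168 / c + 1) * plog N ^ (2 * M + 1) := by ring
      _ ≤ (2 * (168 / c + 1) + (N₀ + 4)) * plog N ^ (2 * M + 1) := by
        gcongr
        exact le_add_of_nonneg_right (by positivity)
  · obtain ⟨P, hsub, hcard⟩ := infinite_unitSq.exists_subset_card_eq N
    refine ⟨P, hcard, hsub, fun φ p w h _ _ _ hR => ?_⟩
    have hP := abs_ncard_inter_rect_sub_le_card (P := P) hR
    rw [hcard] at hP
    have hN' : (N : ℝ) ≤ N₀ + 4 := by
      have : N ≤ N₀ + 4 := by omega
      exact_mod_cast this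
    have hc' : 0 < 2 * (168 / c + 1) := by positivity
    calc _ ≤ (N : ℝ) := hP
      _ ≤ 2 * (168 / c + 1) + (N₀ + 4) := by linarith
      _ ≤ _ := le_mul_of_one_le_right (by positivity) hpow

end
end
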